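/- arXiv:0811.0796 — 15 statements merged into one kernel-verified Lean document; each statement's English description precedes it below -/
import Mathlib

section
/- Let X be a group with identity e. For a family 𝒜 of subsets of X define Φ_𝒜 : P(X) → P(X) by Φ_𝒜(A) = {x ∈ X : x⁻¹A ∈ 𝒜}, and on the double power set P(P(X)) define the binary operation 𝒜∘ℬ = {A ⊆ X : {x ∈ X : x⁻¹A ∈ ℬ} ∈ 𝒜}. Then the map Φ : 𝒜 ↦ Φ_𝒜 is a bijection from P(P(X)) onto the set of all equivariant functions P(X) → P(X), it satisfies Φ_{𝒜∘ℬ} = Φ_𝒜 ∘ Φ_ℬ for all 𝒜, ℬ ∈ P(P(X)), and its inverse is given by φ ↦ {A ⊆ X : e ∈ φ(A)}. In particular, the operation ∘ on P(P(X)) is associative. -/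
open Pointwise

theorem setOf_inv_smul_smul_mem {X : Type*} [Group X] (𝒜 : Set (Set X)) (x : X) (A : Set X) :
    {y : X | y⁻¹ • x • A ∈ 𝒜} = x • {y : X | y⁻¹ • A ∈ 𝒜} := by
  ext y
  simp [Set.mem_smul_set_iff_inv_smul_mem, smul_smul]

theorem setOf_one_mem_of_equivariant {X : Type*} [Group X] {φ : Set X → Set X}
    (hφ : ∀ (x : X) (A : Set X), φ (x • A) = x • φ A) (A : Set X) :
    {x : X | x⁻¹ • A ∈ {B : Set X | (1 : X) ∈ φ B}} = φ A := by
  ext x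
  simp [hφ, Set.mem_smul_set_iff_inv_smul_mem]

/-- The function representation `Φ : 𝒜 ↦ Φ_𝒜` of the double power-set of a group
`X`, where `Φ_𝒜(A) = {x : x⁻¹A ∈ 𝒜}`, is a bijection onto the set of equivariant self-maps of
`P(X)`, turns the operation `𝒜∘ℬ = {A : {x : x⁻¹A ∈ ℬ} ∈ 𝒜}` into composition, has inverse
`φ ↦ {A : e ∈ φ(A)}`, and consequently `∘` is associative. -/
theorem stmt0 {X : Type*} [Group X] :
    let Φ : Set (Set X) → (Set X → Set X) := fun 𝒜 => fun A => {x : X | x⁻¹ • A ∈ 𝒜}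
    let comp : Set (Set X) → Set (Set X) → Set (Set X) :=
      fun 𝒜 ℬ => {A : Set X | {x : X | x⁻¹ • A ∈ ℬ} ∈ 𝒜}
    (∀ (𝒜 : Set (Set X)) (x : X) (A : Set X), Φ 𝒜 (x • A) = x • Φ 𝒜 A) ∧
    Function.Injective Φ ∧
    (∀ φ : Set X → Set X, (∀ (x : X) (A : Set X), φ (x • A) = x • φ A) →
      ∃ 𝒜 : Set (Set X), Φ 𝒜 = φ) ∧
    (∀ 𝒜 ℬ : Set (Set X), Φ (comp 𝒜 ℬ) = Φ 𝒜 ∘ Φ ℬ) ∧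
    (∀ φ : Set X → Set X, (∀ (x : X) (A : Set X), φ (x • A) = x • φ A) →
      Φ {A : Set X | (1 : X) ∈ φ A} = φ) ∧
    (∀ 𝒜 ℬ 𝒞 : Set (Set X), comp (comp 𝒜 ℬ) 𝒞 = comp 𝒜 (comp ℬ 𝒞)) := by
  intro Φ comp
  refine ⟨setOf_inv_smul_smul_mem, fun 𝒜 ℬ h => ?_,
    fun φ hφ => ⟨_, funext (setOf_one_mem_of_equivariant hφ)⟩, fun 𝒜 ℬ => ?_,
    fun φ hφ => funext (setOf_one_mem_of_equivariant hφ), fun 𝒜 ℬ 𝒞 => ?_⟩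
  · ext A
    have hA : (1 : X) ∈ Φ 𝒜 A ↔ (1 : X) ∈ Φ ℬ A := by rw [h]
    simpa [Φ] using hA
  · funext A
    simp only [Φ, comp, Function.comp_apply, Set.mem_ofPred_eq, setOf_inv_smul_smul_mem]
  · ext A
    simp only [comp, Set.mem_ofPred_eq, setOf_inv_smul_smul_mem]
end

section
/- Let X be a group with identity e, let φ : P(X) → P(X) be an equivariant function and let 𝒜 = {A ⊆ X : e ∈ φ(A)}. Then: (1) 𝒜 is monotone (A ∈ 𝒜 and A ⊆ B imply B ∈ 𝒜) if and only if φ is monotone; (2) 𝒜 is left-invariant (A ∈ 𝒜 implies xA ∈ 𝒜 for all x ∈ X) if and only if φ(A) ∈ {∅, X} for every A ⊆ X; (3) 𝒜 is maximal linked if and only if φ is monotone and symmetric. -/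
open Pointwise

section Linked

variable {X : Type*} {𝒜 : Set (Set X)}

/-- A nonempty set that meets every member of a maximal linked family belongs to it. -/
theorem mem_of_maximal_linked (hlinked : ∀ A ∈ 𝒜, ∀ B ∈ 𝒜, (A ∩ B).Nonempty)
    (hmax : ∀ ℒ : Set (Set X), (∀ A ∈ ℒ, ∀ B ∈ ℒ, (A ∩ B).Nonempty) → 𝒜 ⊆ ℒ → ℒ = 𝒜)
    {B : Set X} (hB : B.Nonempty) (hmeet : ∀ A ∈ 𝒜, (A ∩ B).Nonempty) : B ∈ 𝒜 := by
  rw [← hmax (insert B 𝒜) ?_ (Set.subset_insert _ _)]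
  · exact Set.mem_insert _ _
  · rintro C (rfl | hC) D (rfl | hD)
    · rwa [Set.inter_self]
    · rw [Set.inter_comm]
      exact hmeet D hD
    · exact hmeet C hC
    · exact hlinked C hC D hD

/-- A family of subsets of a nonempty set is maximal linked if and only if it is monotone and
contains exactly one of any two complementary sets. -/
theorem maximal_linked_iff [Nonempty X] :
    ((∀ A ∈ 𝒜, ∀ B ∈ 𝒜, (A ∩ B).Nonempty) ∧
        (∀ ℒ : Set (Set X), (∀ A ∈ ℒ, ∀ B ∈ ℒ, (A ∩ B).Nonempty) → 𝒜 ⊆ ℒ → ℒ = 𝒜)) ↔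
      ((∀ A ∈ 𝒜, ∀ B : Set X, A ⊆ B → B ∈ 𝒜) ∧ (∀ A : Set X, Aᶜ ∈ 𝒜 ↔ A ∉ 𝒜)) := by
  constructor
  · rintro ⟨hlinked, hmax⟩
    have hmono : ∀ A ∈ 𝒜, ∀ B : Set X, A ⊆ B → B ∈ 𝒜 := fun A hA B hAB =>
      mem_of_maximal_linked hlinked hmax
        ((hlinked A hA A hA).mono (Set.inter_subset_left.trans hAB))
        fun C hC => (hlinked C hC A hA).mono (Set.inter_subset_inter_right C hAB)
    refine ⟨hmono, fun A => ⟨fun hAc hA => ?_, fun hA => ?_⟩⟩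
    · simpa using hlinked A hA Aᶜ hAc
    · rcases A.eq_empty_or_nonempty with rfl | hne
      · refine mem_of_maximal_linked hlinked hmax (by simp) fun C hC => ?_
        simpa using hlinked C hC C hC
      · by_contra hAc
        refine hA (mem_of_maximal_linked hlinked hmax hne fun C hC => ?_)
        by_contra hCA
        refine hAc (hmono C hC _ ?_)
        rwa [Set.subset_compl_iff_disjoint_right, Set.disjoint_iff_inter_eq_empty,
          ← Set.not_nonempty_iff_eq_empty]
  · rintro ⟨hmono, hcompl⟩
    refine ⟨fun A hA B hB => ?_, fun ℒ hℒ hsub => hsub.antisymm' fun A hA => ?_⟩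
    · by_contra hAB
      refine (hcompl B).1 (hmono A hA _ ?_) hB
      rwa [Set.subset_compl_iff_disjoint_right, Set.disjoint_iff_inter_eq_empty,
        ← Set.not_nonempty_iff_eq_empty]
    · by_contra hA'
      simpa using hℒ A hA Aᶜ (hsub ((hcompl A).2 hA'))

end Linked

/-- For an equivariant function `φ : P(X) → P(X)` on a group `X` and the family
`𝒜 = {A ⊆ X : e ∈ φ(A)}`: (1) `𝒜` is monotone iff `φ` is monotone; (2) `𝒜` is left-invariant
iff `φ` takes only the values `∅` and `X`; (3) `𝒜` is maximal linked iff `φ` is monotone and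
symmetric. -/
theorem stmt1 {X : Type*} [Group X]
    (φ : Set X → Set X) (hφ : ∀ (x : X) (A : Set X), φ (x • A) = x • φ A)
    (𝒜 : Set (Set X)) (h𝒜 : 𝒜 = {A : Set X | (1 : X) ∈ φ A}) :
    ((∀ A ∈ 𝒜, ∀ B : Set X, A ⊆ B → B ∈ 𝒜) ↔
      (∀ A B : Set X, A ⊆ B → φ A ⊆ φ B)) ∧
    ((∀ A ∈ 𝒜, ∀ x : X, x • A ∈ 𝒜) ↔
      (∀ A : Set X, φ A = ∅ ∨ φ A = Set.univ)) ∧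
    (((∀ A ∈ 𝒜, ∀ B ∈ 𝒜, (A ∩ B).Nonempty) ∧
        (∀ ℒ : Set (Set X), (∀ A ∈ ℒ, ∀ B ∈ ℒ, (A ∩ B).Nonempty) → 𝒜 ⊆ ℒ → ℒ = 𝒜)) ↔
      ((∀ A B : Set X, A ⊆ B → φ A ⊆ φ B) ∧ (∀ A : Set X, φ Aᶜ = (φ A)ᶜ))) := by
  have mem_φ : ∀ (x : X) (A : Set X), x ∈ φ A ↔ x⁻¹ • A ∈ 𝒜 := fun x A => by
    simp [h𝒜, hφ, Set.mem_inv_smul_set_iff]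
  have mem_𝒜 : ∀ A : Set X, A ∈ 𝒜 ↔ (1 : X) ∈ φ A := fun A => by simp [h𝒜]
  have hmono : (∀ A ∈ 𝒜, ∀ B : Set X, A ⊆ B → B ∈ 𝒜) ↔
      (∀ A B : Set X, A ⊆ B → φ A ⊆ φ B) := by
    refine ⟨fun h A B hAB x hx => ?_, fun h A hA B hAB => ?_⟩
    · rw [mem_φ] at hx ⊢
      exact h _ hx _ (Set.smul_set_mono hAB)
    · rw [mem_𝒜] at hA ⊢
      exact h A B hAB hA
  have hsymm : (∀ A : Set X, Aᶜ ∈ 𝒜 ↔ A ∉ 𝒜) ↔ (∀ A : Set X, φ Aᶜ = (φ A)ᶜ) := by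
    refine ⟨fun h A => Set.ext fun x => ?_, fun h A => ?_⟩
    · rw [Set.mem_compl_iff, mem_φ, mem_φ, Set.smul_set_compl, h]
    · rw [mem_𝒜, mem_𝒜, h, Set.mem_compl_iff]
  refine ⟨hmono, ⟨fun h A => ?_, fun h A hA x => ?_⟩, ?_⟩
  · rcases (φ A).eq_empty_or_nonempty with hA | ⟨x, hx⟩
    · exact Or.inl hA
    · refine Or.inr (Set.eq_univ_of_forall fun y => ?_)
      rw [mem_φ] at hx ⊢
      simpa [smul_smul] using h _ hx (y⁻¹ * x)
  · rw [mem_𝒜] at hA ⊢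
    rcases h A with hA' | hA'
    · simp [hA'] at hA
    · simp [hφ, hA']
  · rw [maximal_linked_iff, hmono, hsymm]
end

section
/- Let I be a left-invariant ideal on a group X. If L is an I-saturated linked family of subsets of X that is maximal among I-saturated linked families (i.e., every I-saturated linked family of subsets of X containing L equals L), then L is maximal linked: every linked family of subsets of X containing L equals L. -/
open Pointwise

/-- A left-invariant ideal on a group `X`: a collection of subsets containing `∅`, not
containing `X`, closed under subsets and binary unions, and closed under left translations. -/
def IsLeftInvariantIdeal {X : Type*} [Group X] (I : Set (Set X)) : Prop :=
  ∅ ∈ I ∧ Set.univ ∉ I ∧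
  (∀ A ∈ I, ∀ B : Set X, B ⊆ A → B ∈ I) ∧
  (∀ A ∈ I, ∀ B ∈ I, A ∪ B ∈ I) ∧
  (∀ A ∈ I, ∀ x : X, x • A ∈ I)

/-- For a left-invariant ideal `I` on a group `X`, every `I`-saturated linked
family of subsets of `X` which is maximal among `I`-saturated linked families is maximal
linked. -/
theorem stmt2 {X : Type*} [Group X] (I : Set (Set X)) (hI : IsLeftInvariantIdeal I)
    (L : Set (Set X))
    (hlinked : ∀ A ∈ L, ∀ B ∈ L, (A ∩ B).Nonempty)
    (hsat : ∀ A ∈ L, ∀ B : Set X, B \ A ∈ I ∧ A \ B ∈ I → B ∈ L)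
    (hmax : ∀ L' : Set (Set X), (∀ A ∈ L', ∀ B ∈ L', (A ∩ B).Nonempty) →
      (∀ A ∈ L', ∀ B : Set X, B \ A ∈ I ∧ A \ B ∈ I → B ∈ L') → L ⊆ L' → L' = L) :
    ∀ L' : Set (Set X), (∀ A ∈ L', ∀ B ∈ L', (A ∩ B).Nonempty) → L ⊆ L' → L' = L := by
  obtain ⟨hempty, huniv, hsub, hunion, -⟩ := hI
  have cover : ∀ {A B C : Set X}, A ∈ I → B ∈ I → C ⊆ A ∪ B → C ∈ I :=
    fun hA hB h => hsub _ (hunion _ hA _ hB) _ h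
  have hne : L.Nonempty := by
    by_contra hL
    rw [Set.not_nonempty_iff_eq_empty] at hL
    have hfilter := hmax {C | Cᶜ ∈ I} (fun A hA B hB => by
        by_contra h
        rw [Set.not_nonempty_iff_eq_empty] at h
        refine huniv (cover hA hB ?_)
        rw [← Set.compl_inter, h, Set.compl_empty])
      (fun A hA B hB => cover hA hB.2 fun x hx => by
        by_cases hxA : x ∈ A
        · exact Or.inr ⟨hxA, hx⟩
        · exact Or.inl hxA)
      (hL ▸ Set.empty_subset _)
    have hmem : Set.univ ∈ {C : Set X | Cᶜ ∈ I} := by simpa using hempty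
    rw [hfilter, hL] at hmem
    exact hmem
  intro M hM hLM
  refine Set.Subset.antisymm (fun A hA => ?_) hLM
  have hpos : ∀ B ∈ L, A ∩ B ∉ I := by
    intro B hB hAB
    have hdiff : B \ A ∈ L := hsat B hB _
      ⟨hsub _ hempty _ fun x hx => hx.2 hx.1.1,
        hsub _ hAB _ fun x hx => ⟨not_not.1 fun h => hx.2 ⟨hx.1, h⟩, hx.1⟩⟩
    obtain ⟨x, hxA, hx⟩ := hM A hA _ (hLM hdiff)
    exact hx.2 hxA
  have hAI : A ∉ I := by
    obtain ⟨B, hB⟩ := hne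
    exact fun h => hpos B hB (hsub A h _ Set.inter_subset_left)
  have hmeet : ∀ B ∈ L, ∀ C, A \ C ∈ I → (C ∩ B).Nonempty := by
    intro B hB C hC
    by_contra h
    exact hpos B hB (hsub _ hC _ fun x hx => ⟨hx.1, fun hxC => h ⟨x, hxC, hx.2⟩⟩)
  rw [← hmax (L ∪ {C | C \ A ∈ I ∧ A \ C ∈ I}) ?_ ?_ Set.subset_union_left]
  · exact Or.inr (by simpa using hempty)
  · rintro B (hB | hB) C (hC | hC)
    · exact hlinked B hB C hC
    · rw [Set.inter_comm]
      exact hmeet B hB C hC.2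
    · exact hmeet C hC B hB.2
    · by_contra h
      refine hAI (cover hB.2 hC.2 fun x hx => ?_)
      by_cases hxB : x ∈ B
      · exact Or.inr ⟨hx, fun hxC => h ⟨x, hxB, hxC⟩⟩
      · exact Or.inl ⟨hx, hxB⟩
  · rintro C (hC | hC) D hD
    · exact Or.inl (hsat C hC D hD)
    · exact Or.inr ⟨cover hD.1 hC.1 (sdiff_triangle D C A), cover hC.2 hD.2 (sdiff_triangle A C D)⟩
end

section
/- Let I be a left-invariant ideal on a group X and let F be a family of subsets of X that is I-saturated, symmetric (A ∈ F implies X∖A ∈ F) and left-invariant (A ∈ F implies xA ∈ F for all x ∈ X). A function φ : F → P(X) is the restriction to F of some equivariant, monotone, symmetric, I-saturated function P(X) → P(X) if and only if φ is equivariant (φ(xA) = x·φ(A) for all x ∈ X, A ∈ F), symmetric (φ(X∖A) = X∖φ(A) for all A ∈ F), monotone (A ⊆ B implies φ(A) ⊆ φ(B) for A, B ∈ F), and I-saturated (φ(A) = φ(B) whenever A, B ∈ F and A =_I B). -/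
open Pointwise

/-- `A =_I B` : the symmetric difference of `A` and `B` belongs to the ideal `I`. -/
def IdealEqMod {X : Type*} (I : Set (Set X)) (A B : Set X) : Prop :=
  A \ B ∈ I ∧ B \ A ∈ I

/-- A family of subsets of `X` is linked modulo `I` if no two (possibly equal) members have
intersection in `I`. -/
def IdealLinked {X : Type*} (I L : Set (Set X)) : Prop :=
  ∀ A ∈ L, ∀ B ∈ L, A ∩ B ∉ I

/-- Every family linked modulo `I` is contained in a maximal one. -/
theorem IdealLinked.exists_maximal {X : Type*} {I L : Set (Set X)} (hL : IdealLinked I L) :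
    ∃ M, L ⊆ M ∧ Maximal (IdealLinked I) M := by
  refine zorn_subset_nonempty {M | IdealLinked I M} (fun c hc hchain _ => ?_) L hL
  refine ⟨⋃₀ c, ?_, fun s hs => Set.subset_sUnion_of_mem hs⟩
  rintro A ⟨s, hs, hA⟩ B ⟨t, ht, hB⟩
  rcases hchain.total hs ht with h | h
  · exact hc ht A (h hA) B hB
  · exact hc hs A hA B (h hB)

section MaximalLinked

variable {X : Type*} {I M : Set (Set X)}

/-- A set not in `I` that meets every member of a maximal linked family outside `I` belongs to
the family. -/
theorem mem_of_maximal_idealLinked (hM : Maximal (IdealLinked I) M) {B : Set X} (hB : B ∉ I)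
    (h : ∀ C ∈ M, B ∩ C ∉ I) : B ∈ M := by
  have hins : IdealLinked I (insert B M) := by
    rintro A (rfl | hA) C (rfl | hC)
    · rwa [Set.inter_self]
    · exact h C hC
    · rw [Set.inter_comm]
      exact h A hA
    · exact hM.1 A hA C hC
  exact hM.2 hins (Set.subset_insert B M) (Set.mem_insert B M)

theorem univ_mem_of_maximal_idealLinked [Group X] (hI : IsLeftInvariantIdeal I)
    (hM : Maximal (IdealLinked I) M) : Set.univ ∈ M := by
  refine mem_of_maximal_idealLinked hM hI.2.1 fun C hC => ?_
  simpa using hM.1 C hC C hC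

/-- A maximal linked family is closed under supersets modulo `I`. -/
theorem mem_of_maximal_idealLinked_of_diff_mem [Group X] (hI : IsLeftInvariantIdeal I)
    (hM : Maximal (IdealLinked I) M) {A B : Set X} (hA : A ∈ M) (h : A \ B ∈ I) : B ∈ M := by
  have key : ∀ C ∈ M, B ∩ C ∉ I := fun C hC hBC =>
    hM.1 A hA C hC <| hI.2.2.1 _ (hI.2.2.2.1 _ hBC _ h) _ fun x hx => by
      by_cases hxB : x ∈ B
      · exact Or.inl ⟨hxB, hx.2⟩
      · exact Or.inr ⟨hx.1, hxB⟩
  refine mem_of_maximal_idealLinked hM ?_ key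
  simpa using key _ (univ_mem_of_maximal_idealLinked hI hM)

/-- A maximal linked family contains exactly one of any two complementary sets. -/
theorem compl_mem_iff_of_maximal_idealLinked [Group X] (hI : IsLeftInvariantIdeal I)
    (hM : Maximal (IdealLinked I) M) {A : Set X} : Aᶜ ∈ M ↔ A ∉ M := by
  constructor
  · intro hAc hA
    exact hM.1 A hA _ hAc (by simpa using hI.1)
  · have huniv := univ_mem_of_maximal_idealLinked hI hM
    have key : ∀ B, B ∉ M → ∃ C ∈ M, B ∩ C ∈ I := by
      intro B hB
      by_contra! h
      exact hB (mem_of_maximal_idealLinked hM (by simpa using h _ huniv) h)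
    intro hA
    by_contra hAc
    obtain ⟨C, hC, hAC⟩ := key A hA
    obtain ⟨D, hD, hAD⟩ := key _ hAc
    refine hM.1 C hC D hD (hI.2.2.1 _ (hI.2.2.2.1 _ hAC _ hAD) _ fun x hx => ?_)
    by_cases hxA : x ∈ A
    · exact Or.inl ⟨hxA, hx.1⟩
    · exact Or.inr ⟨hxA, hx.2⟩

end MaximalLinked

/-- Let `I` be a left-invariant ideal on a group `X` and `F` an `I`-saturated,
symmetric, left-invariant family of subsets of `X`. A function `φ` defined on `F` extends to an
equivariant, monotone, symmetric, `I`-saturated self-map of `P(X)` if and only if `φ` is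
equivariant, symmetric, monotone and `I`-saturated on `F`. -/
theorem stmt3 {X : Type*} [Group X] (I : Set (Set X)) (hI : IsLeftInvariantIdeal I)
    (F : Set (Set X))
    (hFsat : ∀ A ∈ F, ∀ B : Set X, IdealEqMod I B A → B ∈ F)
    (hFsym : ∀ A ∈ F, Aᶜ ∈ F)
    (hFinv : ∀ A ∈ F, ∀ x : X, x • A ∈ F)
    (φ : Set X → Set X) :
    (∃ ψ : Set X → Set X,
        (∀ (x : X) (A : Set X), ψ (x • A) = x • ψ A) ∧
        (∀ A B : Set X, A ⊆ B → ψ A ⊆ ψ B) ∧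
        (∀ A : Set X, ψ Aᶜ = (ψ A)ᶜ) ∧
        (∀ A B : Set X, IdealEqMod I A B → ψ A = ψ B) ∧
        (∀ A ∈ F, ψ A = φ A)) ↔
    ((∀ (x : X), ∀ A ∈ F, φ (x • A) = x • φ A) ∧
     (∀ A ∈ F, φ Aᶜ = (φ A)ᶜ) ∧
     (∀ A ∈ F, ∀ B ∈ F, A ⊆ B → φ A ⊆ φ B) ∧
     (∀ A ∈ F, ∀ B ∈ F, IdealEqMod I A B → φ A = φ B)) := by
  constructor
  · rintro ⟨ψ, heq, hmono, hsym, hsat, hψ⟩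
    refine ⟨fun x A hA => ?_, fun A hA => ?_, fun A hA B hB h => ?_, fun A hA B hB h => ?_⟩
    · rw [← hψ _ (hFinv A hA x), ← hψ A hA, heq]
    · rw [← hψ _ (hFsym A hA), ← hψ A hA, hsym]
    · rw [← hψ A hA, ← hψ B hB]
      exact hmono A B h
    · rw [← hψ A hA, ← hψ B hB]
      exact hsat A B h
  · rintro ⟨heq, hsym, hmono, hsat⟩
    have hlinked : IdealLinked I {A | A ∈ F ∧ 1 ∈ φ A} := by
      rintro A ⟨hA, h1A⟩ B ⟨hB, h1B⟩ hAB
      have hmod : IdealEqMod I (A ∪ Bᶜ) Bᶜ := by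
        refine ⟨hI.2.2.1 _ hAB _ ?_, hI.2.2.1 _ hI.1 _ ?_⟩
        · rintro x ⟨hx | hx, hxB⟩
          · exact ⟨hx, not_not.mp hxB⟩
          · exact absurd hx hxB
        · rintro x ⟨hx, hx'⟩
          exact hx' (Or.inr hx)
      have hF := hFsat _ (hFsym B hB) _ hmod
      have h1 := hmono A hA _ hF Set.subset_union_left h1A
      rw [hsat _ hF _ (hFsym B hB) hmod, hsym B hB] at h1
      exact h1 h1B
    obtain ⟨M, hsub, hM⟩ := hlinked.exists_maximal
    have hmem : ∀ A ∈ F, ∀ x ∈ φ A, x⁻¹ • A ∈ M := fun A hA x hx =>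
      hsub ⟨hFinv A hA _, by
        rw [heq _ A hA, Set.mem_smul_set_iff_inv_smul_mem]
        simpa using hx⟩
    refine ⟨fun A => {x | x⁻¹ • A ∈ M}, fun x A => ?_, fun A B h x hx => ?_, fun A => ?_,
      fun A B h => ?_, fun A hA => ?_⟩
    · ext y
      simp [Set.mem_smul_set_iff_inv_smul_mem, smul_smul]
    · refine mem_of_maximal_idealLinked_of_diff_mem hI hM hx ?_
      rw [← Set.smul_set_sdiff, Set.sdiff_eq_empty.mpr h, Set.smul_set_empty]
      exact hI.1
    · ext x
      simp only [Set.mem_ofPred_eq, Set.mem_compl_iff, Set.smul_set_compl]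
      exact compl_mem_iff_of_maximal_idealLinked hI hM
    · ext x
      constructor <;> intro hx <;>
        refine mem_of_maximal_idealLinked_of_diff_mem hI hM hx ?_ <;>
        rw [← Set.smul_set_sdiff]
      · exact hI.2.2.2.2 _ h.1 _
      · exact hI.2.2.2.2 _ h.2 _
    · refine Set.Subset.antisymm (fun x hx => ?_) (hmem A hA)
      by_contra hxA
      have hxc := hmem _ (hFsym A hA) x (by rwa [hsym A hA])
      rw [Set.smul_set_compl, compl_mem_iff_of_maximal_idealLinked hI hM] at hxc
      exact hxc hx
end

section
/- Let I be a left-invariant ideal on a group X. If A ⊆ X is an I-twin set, then for every x ∈ X the set xA is I-twin and I-Fix⁻(xA) = x·(I-Fix⁻(A))·x⁻¹. -/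
open Pointwise

lemma IdealEqMod.smul {X : Type*} [Group X] {I : Set (Set X)} (hI : IsLeftInvariantIdeal I)
    {A B : Set X} (h : IdealEqMod I A B) (x : X) : IdealEqMod I (x • A) (x • B) := by
  obtain ⟨-, -, -, -, hsmul⟩ := hI
  refine ⟨?_, ?_⟩
  · rw [← Set.smul_set_sdiff]
    exact hsmul _ h.1 x
  · rw [← Set.smul_set_sdiff]
    exact hsmul _ h.2 x

lemma idealEqMod_smul_iff {X : Type*} [Group X] {I : Set (Set X)} (hI : IsLeftInvariantIdeal I)
    {A B : Set X} (x : X) : IdealEqMod I (x • A) (x • B) ↔ IdealEqMod I A B :=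
  ⟨fun h => by simpa using h.smul hI x⁻¹, fun h => h.smul hI x⟩

/-- For a left-invariant ideal `I` on a group `X`, if `A ⊆ X` is `I`-twin, then
for every `x ∈ X` the set `xA` is `I`-twin and `I-Fix⁻(xA) = x·(I-Fix⁻(A))·x⁻¹`. -/
theorem stmt5 {X : Type*} [Group X] (I : Set (Set X)) (hI : IsLeftInvariantIdeal I)
    (A : Set X) (hA : {z : X | IdealEqMod I (z • A) Aᶜ}.Nonempty) (x : X) :
    {z : X | IdealEqMod I (z • (x • A)) (x • A)ᶜ}.Nonempty ∧
    {z : X | IdealEqMod I (z • (x • A)) (x • A)ᶜ} =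
      (fun z => x * z * x⁻¹) '' {z : X | IdealEqMod I (z • A) Aᶜ} := by
  have key : {z : X | IdealEqMod I (z • (x • A)) (x • A)ᶜ} =
      (fun z => x * z * x⁻¹) '' {z : X | IdealEqMod I (z • A) Aᶜ} := by
    have conj_iff (z : X) : IdealEqMod I ((x * z * x⁻¹) • (x • A)) (x • A)ᶜ ↔
        IdealEqMod I (z • A) Aᶜ := by
      rw [← Set.smul_set_compl, smul_smul, inv_mul_cancel_right, mul_smul,
        idealEqMod_smul_iff hI]
    ext w
    constructor
    · intro hw
      have hconj : x * (x⁻¹ * w * x) * x⁻¹ = w := by group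
      exact ⟨x⁻¹ * w * x, (conj_iff _).1 (by rwa [hconj]), hconj⟩
    · rintro ⟨z, hz, rfl⟩
      exact (conj_iff z).2 hz
  exact ⟨key ▸ hA.image _, key⟩
end

section
/- A group X has trivial twinic ideal (i.e., for every A ⊆ X and x, y ∈ X with xA ⊆ X∖A ⊆ yA one has xA = X∖A = yA) if and only if for all a, b ∈ X the product ab belongs to the subsemigroup of X generated by the four elements ba, ba⁻¹, b⁻¹a, b⁻¹a⁻¹. -/
open Pointwise

section AlternatingWords

variable {X : Type*} [Group X]

/-- The four products `b^±1 * a^±1`. -/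
def signedProducts (a b : X) : Set X := {b * a, b * a⁻¹, b⁻¹ * a, b⁻¹ * a⁻¹}

/-- The subsemigroup generated by the four products `b^±1 * a^±1`. -/
def altSemigroup (a b : X) : Subsemigroup X := Subsemigroup.closure (signedProducts a b)

/-- Elements `w` for which `b^±1 * w` and `b^±1 * w⁻¹` all lie in `altSemigroup a b`, such as the
alternating words in `a^±1` and `b^±1` that start and end with `a^±1`. -/
def IsOddWord (a b w : X) : Prop :=
  (b * w ∈ altSemigroup a b ∧ b⁻¹ * w ∈ altSemigroup a b) ∧
    b * w⁻¹ ∈ altSemigroup a b ∧ b⁻¹ * w⁻¹ ∈ altSemigroup a b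

lemma IsOddWord.inv {a b w : X} (h : IsOddWord a b w) : IsOddWord a b w⁻¹ :=
  ⟨h.2, by rw [inv_inv]; exact h.1⟩

lemma isOddWord_self (a b : X) : IsOddWord a b a := by
  refine ⟨⟨?_, ?_⟩, ?_, ?_⟩ <;> exact Subsemigroup.subset_closure (by simp [signedProducts])

lemma IsOddWord.mul {a b v w : X} (hv : IsOddWord a b v) (hw : IsOddWord a b w) :
    IsOddWord a b (v * (b * w)) := by
  obtain ⟨⟨v₁, v₂⟩, v₃, v₄⟩ := hv
  obtain ⟨⟨w₁, w₂⟩, w₃, w₄⟩ := hw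
  refine ⟨⟨?_, ?_⟩, ?_, ?_⟩
  · simpa [mul_assoc] using mul_mem v₁ w₁
  · simpa [mul_assoc] using mul_mem v₂ w₁
  · simpa [mul_assoc] using mul_mem w₃ v₄
  · simpa [mul_assoc] using mul_mem w₄ v₄

lemma IsOddWord.mul_inv {a b v w : X} (hv : IsOddWord a b v) (hw : IsOddWord a b w) :
    IsOddWord a b (v * (b⁻¹ * w)) := by
  simpa [mul_assoc] using (hw.inv.mul hv.inv).inv

lemma exists_isOddWord_of_mem {a b t : X} (ht : t ∈ altSemigroup a b) :
    ∃ w, IsOddWord a b w ∧ (t = b * w ∨ t = b⁻¹ * w) := by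
  have ha := isOddWord_self a b
  induction ht using Subsemigroup.closure_induction with
  | mem x hx =>
    rcases hx with rfl | rfl | rfl | rfl
    exacts [⟨a, ha, .inl rfl⟩, ⟨a⁻¹, ha.inv, .inl rfl⟩, ⟨a, ha, .inr rfl⟩, ⟨a⁻¹, ha.inv, .inr rfl⟩]
  | mul x y _ _ hx hy =>
    obtain ⟨v, hv, rfl | rfl⟩ := hx <;> obtain ⟨w, hw, rfl | rfl⟩ := hy
    exacts [⟨_, hv.mul hw, .inl (mul_assoc _ _ _)⟩, ⟨_, hv.mul_inv hw, .inl (mul_assoc _ _ _)⟩,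
      ⟨_, hv.mul hw, .inr (mul_assoc _ _ _)⟩, ⟨_, hv.mul_inv hw, .inr (mul_assoc _ _ _)⟩]

lemma isOddWord_of_one_mem {a b : X} (h : 1 ∈ altSemigroup a b) : IsOddWord a b b := by
  obtain ⟨w, hw, h | h⟩ := exists_isOddWord_of_mem h
  · simpa [eq_inv_of_mul_eq_one_right h.symm] using hw.inv
  · rwa [← inv_mul_eq_one.mp h.symm] at hw

lemma IsOddWord.one_mem {a b : X} (h : IsOddWord a b 1) : 1 ∈ altSemigroup a b := by
  simpa using mul_mem h.1.1 h.1.2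

lemma IsOddWord.one_mem_of_self {a b : X} (h : IsOddWord a b b) : 1 ∈ altSemigroup a b := by
  simpa using h.1.2

lemma inv_mem_altSemigroup {a b t : X} (ht : t ∈ altSemigroup a b) : t⁻¹ ∈ altSemigroup b a := by
  induction ht using Subsemigroup.closure_induction with
  | mem x hx =>
    rcases hx with rfl | rfl | rfl | rfl <;>
      exact Subsemigroup.subset_closure (by simp [signedProducts])
  | mul x y _ _ hx hy => simpa using mul_mem hy hx

lemma exists_generator_inv_mem {a b t : X} (ht : t ∈ altSemigroup a b) :
    t⁻¹ ∈ altSemigroup a b → ∃ x ∈ signedProducts a b, x⁻¹ ∈ altSemigroup a b := by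
  induction ht using Subsemigroup.closure_induction with
  | mem x hx => exact fun hi => ⟨x, hx, hi⟩
  | mul x y hx hy ihx _ => exact fun hi => ihx (by simpa [altSemigroup] using mul_mem hy hi)

lemma mul_mem_of_one_mem {a b : X} (h : 1 ∈ altSemigroup a b) : a * b ∈ altSemigroup a b := by
  obtain ⟨⟨hb, -⟩, -, -⟩ := isOddWord_of_one_mem h
  have h' : 1 ∈ altSemigroup b a := by simpa using inv_mem_altSemigroup h
  have ha : a * a ∈ altSemigroup a b := by
    simpa using inv_mem_altSemigroup (isOddWord_of_one_mem h').2.2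
  obtain ⟨x, hx, hi⟩ := exists_generator_inv_mem h (by simpa using h)
  rcases hx with rfl | rfl | rfl | rfl
  · simpa [mul_assoc] using mul_mem (mul_mem ha hi) hb
  · simpa [mul_assoc] using mul_mem hi hb
  · simpa [mul_assoc] using mul_mem ha hi
  · simpa using hi

lemma IsOddWord.mul_closure {a b w m : X} (hw : IsOddWord a b w)
    (hm : m ∈ Submonoid.closure (signedProducts a b)) : IsOddWord a b (w * m) := by
  have ha := isOddWord_self a b
  induction hm using Submonoid.closure_induction generalizing w with
  | mem x hx =>
    rcases hx with rfl | rfl | rfl | rfl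
    exacts [hw.mul ha, hw.mul ha.inv, hw.mul_inv ha, hw.mul_inv ha.inv]
  | one => simpa using hw
  | mul x y _ _ hx hy => simpa [mul_assoc] using hy (hx hw)

lemma IsOddWord.inv_closure_mul {a b w m : X} (hw : IsOddWord a b w)
    (hm : m ∈ Submonoid.closure (signedProducts a b)) : IsOddWord a b (m⁻¹ * w) := by
  simpa using (hw.inv.mul_closure hm).inv

/-- `A` is stable under left multiplication by `b^±1 * a^±1` and contains no pair `x`, `a * x`. -/
structure IsSeparated (a b : X) (A : Set X) : Prop where
  stable : ∀ m ∈ Submonoid.closure (signedProducts a b), ∀ x ∈ A, m * x ∈ A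
  separated : ∀ x ∈ A, a * x ∉ A

/-- The elements of `a • A ∪ a⁻¹ • A` are preserved when a factor `b^±1 * a^±1` is removed. -/
lemma IsSeparated.mem_of_closure_mul {a b m g : X} {A : Set X} (hA : IsSeparated a b A)
    (hm : m ∈ Submonoid.closure (signedProducts a b))
    (hg : a * (m * g) ∈ A ∨ a⁻¹ * (m * g) ∈ A) : a * g ∈ A ∨ a⁻¹ * g ∈ A := by
  induction hm using Submonoid.closure_induction generalizing g with
  | mem x hx =>
    have key : ∀ s ∈ signedProducts a b, ∀ x ∈ A, s * x ∈ A := fun s hs =>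
      hA.stable s (Submonoid.subset_closure hs)
    simp only [signedProducts, Set.mem_insert_iff, Set.mem_singleton_iff, forall_eq_or_imp,
      forall_eq] at key
    obtain ⟨k₁, k₂, k₃, k₄⟩ := key
    rcases hx with rfl | rfl | rfl | rfl <;> rcases hg with hg | hg
    · exact .inl (by simpa [mul_assoc] using k₄ _ hg)
    · exact .inl (by simpa [mul_assoc] using k₃ _ hg)
    · exact .inr (by simpa [mul_assoc] using k₄ _ hg)
    · exact .inr (by simpa [mul_assoc] using k₃ _ hg)
    · exact .inl (by simpa [mul_assoc] using k₂ _ hg)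
    · exact .inl (by simpa [mul_assoc] using k₁ _ hg)
    · exact .inr (by simpa [mul_assoc] using k₂ _ hg)
    · exact .inr (by simpa [mul_assoc] using k₁ _ hg)
  | one => simpa using hg
  | mul x y _ _ hx hy => exact hy (hx (by simpa [mul_assoc] using hg))

lemma mul_closure_ne {a b m n : X} (h : 1 ∉ altSemigroup a b)
    (hm : m ∈ Submonoid.closure (signedProducts a b))
    (hn : n ∈ Submonoid.closure (signedProducts a b)) :
    a * m ≠ n ∧ a * m ≠ n * b ∧ a * (m * b) ≠ n := by
  have hw := ((isOddWord_self a b).mul_closure hm).inv_closure_mul hn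
  refine ⟨fun e => h ?_, fun e => h ?_, fun e => h ?_⟩
  · exact IsOddWord.one_mem (by simpa [e] using hw)
  · exact IsOddWord.one_mem_of_self (by simpa [e] using hw)
  · exact IsOddWord.one_mem_of_self (by simpa [← e, mul_assoc] using hw.inv)

lemma isSeparated_initial {a b : X} (h : 1 ∉ altSemigroup a b) :
    IsSeparated a b {x | ∃ m ∈ Submonoid.closure (signedProducts a b), x = m ∨ x = m * b} where
  stable := by
    rintro n hn _ ⟨m, hm, rfl | rfl⟩
    exacts [⟨_, mul_mem hn hm, .inl rfl⟩, ⟨_, mul_mem hn hm, .inr (mul_assoc _ _ _).symm⟩]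
  separated := by
    rintro _ ⟨m, hm, rfl | rfl⟩ ⟨n, hn, e | e⟩
    · exact (mul_closure_ne h hm hn).1 e
    · exact (mul_closure_ne h hm hn).2.1 e
    · exact (mul_closure_ne h hm hn).2.2 e
    · exact (mul_closure_ne h hm hn).1 (mul_right_cancel ((mul_assoc _ _ _).trans e))

lemma IsSeparated.union {a b g : X} {A : Set X} (h : 1 ∉ altSemigroup a b)
    (hA : IsSeparated a b A) (hg : ¬(a * g ∈ A ∨ a⁻¹ * g ∈ A)) :
    IsSeparated a b (A ∪ {x | ∃ m ∈ Submonoid.closure (signedProducts a b), x = m * g}) where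
  stable := by
    rintro n hn x (hx | ⟨m, hm, rfl⟩)
    exacts [.inl (hA.stable n hn x hx), .inr ⟨_, mul_mem hn hm, (mul_assoc _ _ _).symm⟩]
  separated := by
    rintro x (hx | ⟨m, hm, rfl⟩) (hy | ⟨n, hn, e⟩)
    · exact hA.separated x hx hy
    · exact hg (hA.mem_of_closure_mul hn (.inr (by simpa [← e] using hx)))
    · exact hg (hA.mem_of_closure_mul hm (.inl hy))
    · exact (mul_closure_ne h hm hn).1 (mul_right_cancel ((mul_assoc _ _ _).trans e))

lemma exists_isSeparated_cover {a b : X} (h : 1 ∉ altSemigroup a b) :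
    ∃ A : Set X, IsSeparated a b A ∧ 1 ∈ A ∧ b ∈ A ∧ ∀ g ∉ A, b⁻¹ * g ∈ A := by
  obtain ⟨A, hle, hmax⟩ := zorn_subset_nonempty {A | IsSeparated a b A} (by
    intro c hc hchain _
    refine ⟨⋃₀ c, ⟨?_, ?_⟩, fun s hs => Set.subset_sUnion_of_mem hs⟩
    · rintro m hm x ⟨s, hs, hx⟩
      exact ⟨s, hs, (hc hs).stable m hm x hx⟩
    · rintro x ⟨s, hs, hx⟩ ⟨t, ht, hy⟩
      rcases hchain.total hs ht with hst | hts
      · exact (hc ht).separated x (hst hx) hy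
      · exact (hc hs).separated x hx (hts hy)) _ (isSeparated_initial h)
  refine ⟨A, hmax.prop, hle ⟨1, one_mem _, .inl rfl⟩,
    hle ⟨1, one_mem _, .inr (one_mul b).symm⟩, fun g hg => ?_⟩
  have hA : IsSeparated a b A := hmax.prop
  by_cases hB : a * g ∈ A ∨ a⁻¹ * g ∈ A
  · rcases hB with hB | hB
    · simpa [mul_assoc] using
        hA.stable (b⁻¹ * a⁻¹) (Submonoid.subset_closure (by simp [signedProducts])) _ hB
    · simpa [mul_assoc] using
        hA.stable (b⁻¹ * a) (Submonoid.subset_closure (by simp [signedProducts])) _ hB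
  · exact absurd (hmax.le_of_ge (hA.union h hB) Set.subset_union_left
      (.inr ⟨1, one_mem _, (one_mul g).symm⟩)) hg

lemma altSemigroup_mul_mem {a b t : X} {A : Set X}
    (hAB : ∀ x ∈ A, a * x ∉ A ∧ a⁻¹ * x ∉ A) (hBA : ∀ x ∉ A, b * x ∈ A ∧ b⁻¹ * x ∈ A)
    (ht : t ∈ altSemigroup a b) : ∀ x ∈ A, t * x ∈ A := by
  induction ht using Subsemigroup.closure_induction with
  | mem s hs =>
    intro x hx
    rcases hs with rfl | rfl | rfl | rfl <;> rw [mul_assoc]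
    exacts [(hBA _ (hAB x hx).1).1, (hBA _ (hAB x hx).2).1, (hBA _ (hAB x hx).1).2,
      (hBA _ (hAB x hx).2).2]
  | mul s t _ _ hs ht => exact fun x hx => by simpa [mul_assoc] using hs _ (ht x hx)

end AlternatingWords

/-- A group `X` has trivial twinic ideal (for every `A ⊆ X` and `x, y ∈ X` with
`xA ⊆ X∖A ⊆ yA` one has `xA = X∖A = yA`) if and only if for all `a, b ∈ X` the product `a·b`
belongs to the subsemigroup of `X` generated by `{ba, ba⁻¹, b⁻¹a, b⁻¹a⁻¹}`. -/
theorem stmt6 {X : Type*} [Group X] :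
    (∀ (A : Set X) (x y : X), x • A ⊆ Aᶜ → Aᶜ ⊆ y • A → x • A = Aᶜ ∧ Aᶜ = y • A) ↔
    (∀ a b : X, a * b ∈
      Subsemigroup.closure ({b * a, b * a⁻¹, b⁻¹ * a, b⁻¹ * a⁻¹} : Set X)) := by
  constructor
  · intro h a b
    by_contra hab
    obtain ⟨A, hA, h1, hb, hcov⟩ :=
      exists_isSeparated_cover (a := a) (b := b) fun h1 => hab (mul_mem_of_one_mem h1)
    have hAb := (h A a b (by rintro _ ⟨x, hx, rfl⟩; exact hA.separated x hx)
      fun g hg => ⟨b⁻¹ * g, hcov g hg, by simp⟩).2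
    have : b ∈ b • A := ⟨1, h1, by simp⟩
    exact (hAb ▸ this) hb
  · intro h A x y hx hy
    have hAB : ∀ z ∈ A, x * z ∉ A ∧ x⁻¹ * z ∉ A := fun z hz =>
      ⟨hx ⟨z, hz, rfl⟩, fun hz' => hx ⟨_, hz', by simp⟩ hz⟩
    have hBA : ∀ z ∉ A, y * z ∈ A ∧ y⁻¹ * z ∈ A := fun z hz => by
      have hinv : ∀ w ∉ A, y⁻¹ * w ∈ A := fun w hw => by
        simpa [Set.mem_smul_set_iff_inv_smul_mem] using hy hw
      exact ⟨by_contra fun hyz => hz (by simpa using hinv _ hyz), hinv z hz⟩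
    refine ⟨hx.antisymm fun z hz => ?_, hy.antisymm ?_⟩
    · rw [Set.mem_smul_set_iff_inv_smul_mem, smul_eq_mul]
      by_contra hw
      have := altSemigroup_mul_mem (A := Aᶜ) (fun w hw => by simpa using hBA w hw)
        (fun w hw => hAB w (by simpa using hw)) (h y x) _ hw
      exact this (by simpa [mul_assoc] using (hBA z hz).1)
    · rintro _ ⟨z, hz, rfl⟩ hyz
      have := altSemigroup_mul_mem hAB hBA (h x y) z hz
      exact (hAB _ hyz).1 (by simpa [mul_assoc] using this)
end

section
/- Let X be a group and let μ : P(X) → ℝ be a left-invariant finitely additive probability measure defined on all subsets of X, i.e., μ(A) ≥ 0 for all A ⊆ X, μ(X) = 1, μ(A ∪ B) = μ(A) + μ(B) for disjoint A, B ⊆ X, and μ(xA) = μ(A) for all x ∈ X, A ⊆ X. Then N_μ = {A ⊆ X : μ(A) = 0} is a left-invariant ideal on X and N_μ is twinic; in particular, every group admitting such a measure (every amenable group) is twinic. -/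
open Pointwise

/-- A left-invariant ideal `I` on a group `X` is twinic if `xA ⊆_I X∖A ⊆_I yA` implies
`xA =_I yA`. -/
def IsTwinicIdeal {X : Type*} [Group X] (I : Set (Set X)) : Prop :=
  ∀ (A : Set X) (x y : X), (x • A) \ Aᶜ ∈ I → Aᶜ \ (y • A) ∈ I →
    ((x • A) \ (y • A) ∈ I ∧ (y • A) \ (x • A) ∈ I)

/-- If `μ` is a left-invariant finitely additive probability measure defined on
all subsets of a group `X`, then `N_μ = {A : μ(A) = 0}` is a left-invariant ideal on `X` and
`N_μ` is twinic; in particular every amenable group is twinic. -/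
theorem stmt7 {X : Type*} [Group X] (μ : Set X → ℝ)
    (h0 : ∀ A : Set X, 0 ≤ μ A) (h1 : μ Set.univ = 1)
    (hadd : ∀ A B : Set X, Disjoint A B → μ (A ∪ B) = μ A + μ B)
    (hinv : ∀ (x : X) (A : Set X), μ (x • A) = μ A) :
    IsLeftInvariantIdeal {A : Set X | μ A = 0} ∧
    IsTwinicIdeal {A : Set X | μ A = 0} := by
  have hdiff : ∀ A B : Set X, μ A = μ (A \ B) + μ (A ∩ B) := fun A B => by
    rw [← hadd _ _ Set.disjoint_sdiff_inter, Set.sdiff_union_inter]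
  have hempty : μ ∅ = 0 := by simpa using hadd ∅ ∅ (Set.disjoint_empty _)
  have hmono : ∀ A B : Set X, B ⊆ A → μ B ≤ μ A := fun A B h => by
    have := hdiff A B
    rw [Set.inter_eq_self_of_subset_right h] at this
    linarith [h0 (A \ B)]
  have hnull : ∀ A B : Set X, B ⊆ A → μ A = 0 → μ B = 0 := fun A B h hA =>
    le_antisymm (hA ▸ hmono A B h) (h0 B)
  have hunion : ∀ A B : Set X, μ A = 0 → μ B = 0 → μ (A ∪ B) = 0 := fun A B hA hB => by
    rw [← Set.union_sdiff_self, hadd _ _ Set.disjoint_sdiff_right, hA,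
      hnull B _ Set.sdiff_subset hB, add_zero]
  refine ⟨⟨hempty, by simp [h1], fun A hA B h => hnull A B h hA,
    fun A hA B hB => hunion A B hA hB, fun A hA x => (hinv x A).trans hA⟩, ?_⟩
  intro A x y hx hy
  have hxy : μ ((x • A) \ (y • A)) = 0 :=
    hnull _ _ (sdiff_triangle _ _ _) (hunion _ _ hx hy)
  refine ⟨hxy, ?_⟩
  have hl := hdiff (x • A) (y • A)
  have hr := hdiff (y • A) (x • A)
  rw [hinv] at hl hr
  rw [Set.inter_comm] at hr
  change μ ((y • A) \ (x • A)) = 0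
  linarith
end

section
/- Let X be a group in which every commutator [x,y] = x·y·x⁻¹·y⁻¹ has finite order. Then X has trivial twinic ideal: for every A ⊆ X and x, y ∈ X with xA ⊆ X∖A ⊆ yA one has xA = X∖A = yA. -/
open Pointwise

/-- If an element of finite order maps a set into itself, then so does its inverse. -/
theorem IsOfFinOrder.inv_mul_mem {X : Type*} [Group X] {g : X} (hg : IsOfFinOrder g)
    {A : Set X} (hA : ∀ a ∈ A, g * a ∈ A) : ∀ a ∈ A, g⁻¹ * a ∈ A := by
  have hpow : ∀ n : ℕ, ∀ a ∈ A, g ^ n * a ∈ A := by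
    intro n
    induction n with
    | zero => simp
    | succ k ih =>
      intro a ha
      rw [pow_succ, mul_assoc]
      exact ih _ (hA a ha)
  obtain ⟨n, hn, hgn⟩ := isOfFinOrder_iff_pow_eq_one.mp hg
  obtain ⟨k, rfl⟩ := Nat.exists_eq_succ_of_ne_zero hn.ne'
  have hinv : g⁻¹ = g ^ k := by
    rw [inv_eq_iff_mul_eq_one, ← pow_succ']
    exact hgn
  rw [hinv]
  exact hpow k

/-- If every commutator `x·y·x⁻¹·y⁻¹` of a group `X` has finite order, then `X`
has trivial twinic ideal: for every `A ⊆ X` and `x, y ∈ X` with `xA ⊆ X∖A ⊆ yA` one has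
`xA = X∖A = yA`. -/
theorem stmt8 {X : Type*} [Group X]
    (h : ∀ x y : X, IsOfFinOrder (x * y * x⁻¹ * y⁻¹)) :
    ∀ (A : Set X) (x y : X), x • A ⊆ Aᶜ → Aᶜ ⊆ y • A → x • A = Aᶜ ∧ Aᶜ = y • A := by
  intro A x y hxA hyA
  have hx : ∀ a ∈ A, x * a ∉ A := fun a ha => hxA ⟨a, ha, rfl⟩
  have hx' : ∀ a ∈ A, x⁻¹ * a ∉ A := fun a ha hmem => hx _ hmem (by simpa using ha)
  have hy' : ∀ b ∉ A, y⁻¹ * b ∈ A := fun b hb => Set.mem_smul_set_iff_inv_smul_mem.mp (hyA hb)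
  have hy : ∀ b ∉ A, y * b ∈ A := by
    intro b hb
    by_contra hmem
    exact hb (by simpa using hy' _ hmem)
  have hcomm : ∀ a ∈ A, (y * x * y⁻¹ * x⁻¹)⁻¹ * a ∈ A := by
    refine (h y x).inv_mul_mem fun a ha => ?_
    simpa only [mul_assoc] using hy _ (hx _ (hy' _ (hx' a ha)))
  have hxy : ∀ a ∈ A, x * (y * a) ∈ A := by
    intro a ha
    simpa [mul_assoc] using hcomm _ (hy _ (hx a ha))
  refine ⟨hxA.antisymm fun b hb => ?_, hyA.antisymm ?_⟩
  · rw [Set.mem_smul_set_iff_inv_smul_mem, smul_eq_mul]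
    by_contra hmem
    have hxb := hxy _ (hy' _ hmem)
    exact hb (by simpa using hxb)
  · rintro _ ⟨a, ha, rfl⟩ hmem
    exact hx _ hmem (hxy a ha)
end

section
/- Let X be the infinite dihedral group (the isometry group of ℤ, i.e., the dihedral group D_∞, realized in Lean as DihedralGroup 0). Then: (1) the ideal of finite subsets of X is twinic, i.e., for every A ⊆ X and x, y ∈ X, if xA∖(X∖A) and (X∖A)∖yA are finite then yA∖xA is finite; and (2) the trivial ideal is not twinic: there exist A ⊆ X and x, y ∈ X with xA ⊆ X∖A ⊆ yA but xA ≠ yA. -/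
open Pointwise

/-- If a set of integers has finitely many ascents, then it has finitely many descents. -/
lemma Int.finite_descents_of_finite_ascents {p : ℤ → Prop}
    (h : {n | p n ∧ ¬ p (n - 1)}.Finite) : {n | p (n - 1) ∧ ¬ p n}.Finite := by
  obtain ⟨u, hu⟩ := h.bddAbove
  obtain ⟨l, hl⟩ := h.bddBelow
  have step : ∀ n, n < l ∨ u < n → ¬ p (n - 1) → ¬ p n := fun n hn hp hq ↦ by
    have h₁ : n ≤ u := hu ⟨hq, hp⟩
    have h₂ : l ≤ n := hl ⟨hq, hp⟩
    omega
  have upper : {n | (p (n - 1) ∧ ¬ p n) ∧ u < n}.Subsingleton := by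
    have key : ∀ m n, u < m → ¬ p m → m ≤ n → ¬ p n := fun m n hm hp hmn ↦
      Int.leInduction (motive := fun k _ ↦ ¬ p k) hp
        (fun k hk ih ↦ step (k + 1) (by omega) (by simpa using ih)) n hmn
    rintro m ⟨⟨hm₁, hm₂⟩, hm⟩ n ⟨⟨hn₁, hn₂⟩, hn⟩
    rcases lt_trichotomy m n with hlt | heq | hlt
    · exact absurd hn₁ (key m (n - 1) hm hm₂ (by omega))
    · exact heq
    · exact absurd hm₁ (key n (m - 1) hn hn₂ (by omega))
  have lower : {n | (p (n - 1) ∧ ¬ p n) ∧ n < l}.Subsingleton := by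
    have key : ∀ m n, n < l → p n → m ≤ n → p m := fun m n hn hp hmn ↦
      Int.leInductionDown (motive := fun k _ ↦ p k) hp
        (fun k hk ih ↦ by_contra fun hk' ↦ step k (by omega) hk' ih) m hmn
    rintro m ⟨⟨hm₁, hm₂⟩, hm⟩ n ⟨⟨hn₁, hn₂⟩, hn⟩
    rcases lt_trichotomy m n with hlt | heq | hlt
    · exact absurd (key m (n - 1) (by omega) hn₁ (by omega)) hm₂
    · exact heq
    · exact absurd (key n (m - 1) (by omega) hm₁ (by omega)) hn₂
  refine ((upper.finite.union lower.finite).union (Set.finite_Icc l u)).subset fun n hn ↦ ?_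
  rcases lt_or_ge n l with h₁ | h₁
  · exact .inl (.inr ⟨hn, h₁⟩)
  · rcases lt_or_ge u n with h₂ | h₂
    · exact .inl (.inl ⟨hn, h₂⟩)
    · exact .inr ⟨h₁, h₂⟩

/-- If left multiplication by an element `z` of infinite order has finitely many orbits, then
a set almost contained in its translate by `z` is almost equal to it. -/
lemma Set.Finite.smul_sdiff_of_sdiff_smul {G : Type*} [Group G] {z : G} {T A : Set G}
    (hz : Function.Injective fun n : ℤ ↦ z ^ n) (hT : T.Finite)
    (hcover : ∀ g, ∃ t ∈ T, ∃ n : ℤ, z ^ n * t = g)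
    (h : (A \ z • A).Finite) : (z • A \ A).Finite := by
  have shift : ∀ (t : G) (n : ℤ), z ^ n * t ∈ z • A ↔ z ^ (n - 1) * t ∈ A := fun t n ↦ by
    rw [Set.mem_smul_set_iff_inv_smul_mem, smul_eq_mul, ← mul_assoc, ← zpow_neg_one, ← zpow_add,
      neg_add_eq_sub]
  have orbit : ∀ t, {n : ℤ | z ^ (n - 1) * t ∈ A ∧ ¬ z ^ n * t ∈ A}.Finite := fun t ↦ by
    refine Int.finite_descents_of_finite_ascents (p := fun n ↦ z ^ n * t ∈ A) ?_
    refine (h.preimage ((mul_left_injective t).comp hz).injOn).subset fun n hn ↦ ?_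
    exact ⟨hn.1, fun hn' ↦ hn.2 ((shift t n).1 hn')⟩
  refine (hT.biUnion fun t _ ↦ (orbit t).image fun n ↦ z ^ n * t).subset fun g hg ↦ ?_
  obtain ⟨t, ht, n, rfl⟩ := hcover g
  exact Set.mem_biUnion ht ⟨n, ⟨(shift t n).1 hg.1, hg.2⟩, rfl⟩

namespace DihedralGroup

/-- In the infinite dihedral group, a set almost contained in a left translate of itself is
almost equal to this translate. -/
lemma finite_smul_sdiff {A : Set (DihedralGroup 0)} (z : DihedralGroup 0)
    (h : (A \ z • A).Finite) : (z • A \ A).Finite := by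
  rcases z with (k : ℤ) | k
  · rcases eq_or_ne k 0 with rfl | hk
    · have hone : (r (0 : ℤ) : DihedralGroup 0) = 1 := rfl
      simp [hone]
    have hpow (n : ℤ) : (r k : DihedralGroup 0) ^ n = r (k * n : ℤ) := by
      conv_rhs => rw [← Int.cast_id (n := n)]
      exact r_zpow (n := 0) k n
    refine Set.Finite.smul_sdiff_of_sdiff_smul
      (T := (fun i : ℤ ↦ (r i : DihedralGroup 0)) '' Set.Ico 0 |k| ∪
        (fun i : ℤ ↦ (sr i : DihedralGroup 0)) '' Set.Ico 0 |k|)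
      (fun m n hmn ↦ ?_) (((Set.finite_Ico _ _).image _).union ((Set.finite_Ico _ _).image _))
      (fun g ↦ ?_) h
    · simp only [hpow] at hmn
      exact mul_left_cancel₀ hk (r.inj hmn)
    · rcases g with (j : ℤ) | (j : ℤ)
      · refine ⟨_, .inl ⟨j % k, ⟨Int.emod_nonneg j hk, Int.emod_lt_abs j hk⟩, rfl⟩, j / k, ?_⟩
        rw [hpow]
        exact congrArg r (Int.mul_ediv_add_emod j k)
      · refine ⟨_, .inr ⟨j % k, ⟨Int.emod_nonneg j hk, Int.emod_lt_abs j hk⟩, rfl⟩, -(j / k), ?_⟩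
        rw [hpow]
        refine congrArg sr (?_ : j % k - k * -(j / k) = j)
        linarith [Int.mul_ediv_add_emod j k]
  · have := h.smul_set (a := (sr k : DihedralGroup 0))
    rwa [Set.smul_set_sdiff, smul_smul, sr_mul_self, one_smul] at this

end DihedralGroup

/-- In the infinite dihedral group `X = Iso(ℤ) = DihedralGroup 0`:
(1) the ideal of finite subsets is twinic: for every `A ⊆ X` and `x, y ∈ X`, if `xA ∖ (X∖A)`
and `(X∖A) ∖ yA` are finite then `yA ∖ xA` is finite;
(2) the trivial ideal is not twinic: there are `A ⊆ X` and `x, y ∈ X` with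
`xA ⊆ X∖A ⊆ yA` but `xA ≠ yA`. -/
theorem stmt9 :
    (∀ (A : Set (DihedralGroup 0)) (x y : DihedralGroup 0),
        ((x • A) \ Aᶜ).Finite → (Aᶜ \ (y • A)).Finite → ((y • A) \ (x • A)).Finite) ∧
    (∃ (A : Set (DihedralGroup 0)) (x y : DihedralGroup 0),
        x • A ⊆ Aᶜ ∧ Aᶜ ⊆ y • A ∧ x • A ≠ y • A) := by
  constructor
  · intro A x y hx hy
    have hxy : (x • A \ y • A).Finite := (hx.union hy).subset fun g hg ↦ by
      by_cases hgA : g ∈ Aᶜ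
      · exact .inr ⟨hgA, hg.2⟩
      · exact .inl ⟨hg.1, hgA⟩
    have hA := hxy.smul_set (a := x⁻¹)
    rw [Set.smul_set_sdiff, inv_smul_smul, smul_smul] at hA
    have := (DihedralGroup.finite_smul_sdiff _ hA).smul_set (a := x)
    rwa [Set.smul_set_sdiff, smul_smul, mul_inv_cancel_left] at this
  · let f : DihedralGroup 0 → Prop := fun g ↦ match g with
      | .r j => LE.le (α := ℤ) 0 j
      | .sr j => LT.lt (α := ℤ) j 0
    have hr (j : ℤ) : f (.r j) ↔ 0 ≤ j := Iff.rfl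
    have hs (j : ℤ) : f (.sr j) ↔ j < 0 := Iff.rfl
    have mem (k : ℤ) (g : DihedralGroup 0) :
        g ∈ (.sr k : DihedralGroup 0) • {g | f g} ↔ f (.sr k * g) := by
      rw [Set.mem_smul_set_iff_inv_smul_mem]
      rfl
    have mulr (k j : ℤ) : (.sr k * .r j : DihedralGroup 0) = .sr (k + j : ℤ) := rfl
    have muls (k j : ℤ) : (.sr k * .sr j : DihedralGroup 0) = .r (j - k : ℤ) := rfl
    refine ⟨{g | f g}, .sr (0 : ℤ), .sr (-1 : ℤ), ?_, ?_, fun h ↦ ?_⟩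
    · rintro ((j : ℤ) | (j : ℤ)) hg <;>
        simp only [mem, mulr, muls, hr, hs, Set.mem_compl_iff, Set.mem_ofPred_eq] at hg ⊢ <;> omega
    · rintro ((j : ℤ) | (j : ℤ)) hg <;>
        simp only [mem, mulr, muls, hr, hs, Set.mem_compl_iff, Set.mem_ofPred_eq] at hg ⊢ <;> omega
    · have h₀ := Set.ext_iff.1 h (.r (0 : ℤ))
      simp only [mem, mulr, hs] at h₀
      omega
end

section
/- The free group F₂ on two generators is not twinic: no left-invariant ideal I on F₂ is twinic, i.e., for every left-invariant ideal I on F₂ there exist A ⊆ F₂ and x, y ∈ F₂ with xA ⊆_I F₂∖A and F₂∖A ⊆_I yA but not xA =_I yA. -/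
open Pointwise

/-- An involution of `ℤ` exchanging the multiples of `3` with the non-multiples of `3`. -/
def swapThree (n : ℤ) : ℤ :=
  if n % 6 = 0 then n / 2 + 1
  else if n % 6 = 3 then (n - 3) / 2 + 2
  else if n % 3 = 1 then 2 * (n - 1)
  else 2 * (n - 2) + 3

lemma swapThree_involutive : Function.Involutive swapThree := by
  intro n
  unfold swapThree
  split_ifs <;> omega

lemma swapThree_emod_three {n : ℤ} (hn : n % 3 ≠ 0) : swapThree n % 3 = 0 := by
  unfold swapThree
  split_ifs <;> omega

/-- The action of `F₂` on `ℤ` in which the first generator acts by `swapThree` and the second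
one by translation by `1`. -/
def intAction : FreeGroup (Fin 2) →* Equiv.Perm ℤ :=
  FreeGroup.lift ![swapThree_involutive.toPerm, Equiv.addRight 1]

/-- The elements of `F₂` sending `0` to a multiple of `3`. -/
def multThree : Set (FreeGroup (Fin 2)) := {g | intAction g 0 % 3 = 0}

lemma intAction_inv_of_zero (g : FreeGroup (Fin 2)) :
    intAction ((FreeGroup.of 0)⁻¹ * g) 0 = swapThree (intAction g 0) := by
  rw [map_mul, map_inv, Equiv.Perm.mul_apply, Equiv.Perm.inv_eq_iff_eq]
  simp [intAction, swapThree_involutive _]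

lemma intAction_inv_of_one (g : FreeGroup (Fin 2)) :
    intAction ((FreeGroup.of 1)⁻¹ * g) 0 = intAction g 0 - 1 := by
  rw [map_mul, map_inv, Equiv.Perm.mul_apply, Equiv.Perm.inv_eq_iff_eq]
  simp [intAction]

lemma mem_smul_multThree {x g : FreeGroup (Fin 2)} :
    g ∈ x • multThree ↔ intAction (x⁻¹ * g) 0 % 3 = 0 := by
  rw [Set.mem_smul_set_iff_inv_smul_mem]
  rfl

lemma mem_of_one_smul {g : FreeGroup (Fin 2)} :
    g ∈ FreeGroup.of (1 : Fin 2) • multThree ↔ (intAction g 0 - 1) % 3 = 0 := by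
  rw [mem_smul_multThree, intAction_inv_of_one]

lemma mem_of_one_mul_self_smul {g : FreeGroup (Fin 2)} :
    g ∈ (FreeGroup.of (1 : Fin 2) * FreeGroup.of 1) • multThree ↔
      (intAction g 0 - 2) % 3 = 0 := by
  rw [mem_smul_multThree, mul_inv_rev, mul_assoc, intAction_inv_of_one, intAction_inv_of_one,
    sub_sub]
  rfl

lemma compl_multThree_subset : multThreeᶜ ⊆ FreeGroup.of (0 : Fin 2) • multThree := by
  intro g hg
  rw [mem_smul_multThree, intAction_inv_of_zero]
  exact swapThree_emod_three hg

/-- The free group `F₂` on two generators is not twinic: for every left-invariant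
ideal `I` on `F₂` there exist `A ⊆ F₂` and `x, y ∈ F₂` with `xA ⊆_I F₂∖A` and `F₂∖A ⊆_I yA`
but not `xA =_I yA`. -/
theorem stmt10 (I : Set (Set (FreeGroup (Fin 2)))) (hI : IsLeftInvariantIdeal I) :
    ∃ (A : Set (FreeGroup (Fin 2))) (x y : FreeGroup (Fin 2)),
      (x • A) \ Aᶜ ∈ I ∧ Aᶜ \ (y • A) ∈ I ∧
      ¬((x • A) \ (y • A) ∈ I ∧ (y • A) \ (x • A) ∈ I) := by
  by_contra! h
  obtain ⟨hempty, huniv, hsub, hunion, hsmul⟩ := hI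
  have mem_of_eq_empty {A : Set (FreeGroup (Fin 2))} (hA : A = ∅) : A ∈ I := hA ▸ hempty
  set a : FreeGroup (Fin 2) := FreeGroup.of 0
  set b : FreeGroup (Fin 2) := FreeGroup.of 1
  have hcompl : multThreeᶜ \ (a • multThree) ∈ I :=
    mem_of_eq_empty (Set.sdiff_eq_empty.2 compl_multThree_subset)
  have hb : (b • multThree) \ multThreeᶜ ∈ I := by
    refine mem_of_eq_empty (Set.sdiff_eq_empty.2 fun g hg hg' => ?_)
    have := mem_of_one_smul.1 hg
    change intAction g 0 % 3 = 0 at hg'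
    omega
  have hbb : ((b * b) • multThree) \ multThreeᶜ ∈ I := by
    refine mem_of_eq_empty (Set.sdiff_eq_empty.2 fun g hg hg' => ?_)
    have := mem_of_one_mul_self_smul.1 hg
    change intAction g 0 % 3 = 0 at hg'
    omega
  have hba := (h multThree b a hb hcompl).1
  have habb := (h multThree (b * b) a hbb hcompl).2
  have hbI : b • multThree ∈ I := by
    refine hsub _ (hunion _ hba _ habb) _ fun g hg => ?_
    have hg' : g ∉ (b * b) • multThree := fun hg' => by
      have h1 := mem_of_one_smul.1 hg
      have h2 := mem_of_one_mul_self_smul.1 hg'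
      omega
    by_cases hga : g ∈ a • multThree
    · exact Or.inr ⟨hga, hg'⟩
    · exact Or.inl ⟨hg, hga⟩
  have hA : multThree ∈ I := by simpa using hsmul _ hbI b⁻¹
  have hAc : multThreeᶜ ∈ I := hsub _ (hsmul _ hA a) _ compl_multThree_subset
  exact huniv (Set.union_compl_self multThree ▸ hunion _ hA _ hAc)
end

section
/- Let X be a group. Then: (1) for every nonempty family C of 2-cogroups of X that is linearly ordered by inclusion, the union ⋃C is a 2-cogroup of X; (2) every 2-cogroup of X is contained in a maximal 2-cogroup; (3) for every maximal 2-cogroup K of X there exists a twin subset A ⊆ X with Fix⁻(A) = K. -/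
open Pointwise

/-- A (nonempty) subset `K` of a group `X` is a 2-cogroup if for every `x ∈ K` the shift
`xK = Kx` is the carrier of a subgroup of `X` disjoint from `K`. -/
def IsTwoCogroup {X : Type*} [Group X] (K : Set X) : Prop :=
  K.Nonempty ∧ ∀ x ∈ K,
    x • K = (fun k => k * x) '' K ∧
    (∃ H : Subgroup X, (H : Set X) = x • K) ∧
    Disjoint (x • K) K

/-- A maximal 2-cogroup: a 2-cogroup maximal by inclusion among 2-cogroups. -/
def IsMaxTwoCogroup {X : Type*} [Group X] (K : Set X) : Prop :=
  IsTwoCogroup K ∧ ∀ K' : Set X, IsTwoCogroup K' → K ⊆ K' → K' = K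

/-- An elementwise description of 2-cogroups. -/
theorem isTwoCogroup_iff {X : Type*} [Group X] {K : Set X} :
    IsTwoCogroup K ↔ K.Nonempty ∧ (∀ x ∈ K, x⁻¹ ∈ K) ∧
      (∀ x ∈ K, ∀ y ∈ K, ∀ z ∈ K, x * y * z ∈ K) ∧ ∀ x ∈ K, ∀ y ∈ K, x * y ∉ K := by
  constructor
  · rintro ⟨hne, h⟩
    refine ⟨hne, fun x hx => ?_, fun x hx y hy z hz => ?_, fun x hx y hy hxy => ?_⟩
    · obtain ⟨-, ⟨H, hH⟩, -⟩ := h x hx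
      have h1 : (1 : X) ∈ x • K := hH ▸ H.one_mem
      simpa [Set.mem_smul_set_iff_inv_smul_mem] using h1
    · obtain ⟨hc, ⟨H, hH⟩, -⟩ := h y hy
      have hmem : ∀ k ∈ K, k * y ∈ H := fun k hk => by
        rw [← SetLike.mem_coe, hH, hc]
        exact ⟨k, hk, rfl⟩
      have hxz : x * y * (z * y) ∈ (fun k => k * y) '' K := by
        rw [← hc, ← hH]
        exact H.mul_mem (hmem x hx) (hmem z hz)
      obtain ⟨k, hk, he⟩ := hxz
      have hkz : k = x * y * z := mul_right_cancel (b := y) (by simpa [mul_assoc] using he)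
      exact hkz ▸ hk
    · exact Set.disjoint_left.1 (h x hx).2.2 (Set.smul_mem_smul_set hy) hxy
  · rintro ⟨hne, hinv, htri, hmul⟩
    refine ⟨hne, fun x hx => ⟨?_, ⟨⟨⟨⟨x • K, ?_⟩, ?_⟩, ?_⟩, rfl⟩, ?_⟩⟩
    · ext g
      constructor
      · rintro ⟨k, hk, rfl⟩
        exact ⟨x * k * x⁻¹, htri x hx k hk _ (hinv x hx), by simp⟩
      · rintro ⟨k, hk, rfl⟩
        exact ⟨x⁻¹ * k * x, htri _ (hinv x hx) k hk x hx, by simp [mul_assoc]⟩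
    · rintro _ _ ⟨a, ha, rfl⟩ ⟨b, hb, rfl⟩
      exact ⟨a * x * b, htri a ha x hx b hb, by simp [mul_assoc]⟩
    · exact ⟨x⁻¹, hinv x hx, by simp⟩
    · rintro _ ⟨a, ha, rfl⟩
      exact ⟨x⁻¹ * a⁻¹ * x⁻¹, htri _ (hinv x hx) _ (hinv a ha) _ (hinv x hx), by
        simp [mul_assoc]⟩
    · rw [Set.disjoint_left]
      rintro _ ⟨a, ha, rfl⟩
      exact hmul x hx a ha

theorem IsTwoCogroup.sUnion {X : Type*} [Group X] {C : Set (Set X)} (hne : C.Nonempty)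
    (hC : ∀ K ∈ C, IsTwoCogroup K) (hchain : IsChain (· ⊆ ·) C) : IsTwoCogroup (⋃₀ C) := by
  have hdir := hchain.directedOn
  have hC' := fun K hK => isTwoCogroup_iff.1 (hC K hK)
  rw [isTwoCogroup_iff]
  refine ⟨?_, ?_, ?_, ?_⟩
  · obtain ⟨K, hK⟩ := hne
    exact (hC K hK).1.mono (Set.subset_sUnion_of_mem hK)
  · rintro x ⟨K, hK, hx⟩
    exact ⟨K, hK, (hC' K hK).2.1 x hx⟩
  · rintro x ⟨K, hK, hx⟩ y ⟨L, hL, hy⟩ z ⟨M, hM, hz⟩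
    obtain ⟨N, hN, hKN, hLN⟩ := hdir K hK L hL
    obtain ⟨P, hP, hNP, hMP⟩ := hdir N hN M hM
    exact ⟨P, hP, (hC' P hP).2.2.1 x (hNP (hKN hx)) y (hNP (hLN hy)) z (hMP hz)⟩
  · rintro x ⟨K, hK, hx⟩ y ⟨L, hL, hy⟩ ⟨M, hM, hxy⟩
    obtain ⟨N, hN, hKN, hLN⟩ := hdir K hK L hL
    obtain ⟨P, hP, hNP, hMP⟩ := hdir N hN M hM
    exact (hC' P hP).2.2.2 x (hNP (hKN hx)) y (hNP (hLN hy)) (hMP hxy)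

theorem IsTwoCogroup.exists_isMaxTwoCogroup {X : Type*} [Group X] {K : Set X}
    (hK : IsTwoCogroup K) : ∃ M : Set X, IsMaxTwoCogroup M ∧ K ⊆ M := by
  obtain ⟨M, hKM, hM⟩ := zorn_subset_nonempty {L : Set X | IsTwoCogroup L}
    (fun C hC hchain hne => ⟨⋃₀ C, IsTwoCogroup.sUnion hne (fun L hL => hC hL) hchain,
      fun _ => Set.subset_sUnion_of_mem⟩) K hK
  exact ⟨M, ⟨hM.prop, fun L hL hML => (hM.eq_of_subset hL hML).symm⟩, hKM⟩

/-- If `Fix⁻(A)` is nonempty, it is a 2-cogroup. -/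
theorem isTwoCogroup_setOf_smul_eq_compl {X : Type*} [Group X] {A : Set X}
    (hne : {x : X | x • A = Aᶜ}.Nonempty) : IsTwoCogroup {x : X | x • A = Aᶜ} := by
  have hmul : ∀ x y : X, x • A = Aᶜ → y • A = Aᶜ → (x * y) • A = A := fun x y hx hy => by
    rw [mul_smul, hy, Set.smul_set_compl, hx, compl_compl]
  rw [isTwoCogroup_iff]
  refine ⟨hne, fun x hx => ?_, fun x hx y hy z hz => ?_, fun x hx y hy hxy => ?_⟩
  · change x⁻¹ • A = Aᶜ
    rw [inv_smul_eq_iff, Set.smul_set_compl, show x • A = Aᶜ from hx, compl_compl]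
  · change (x * y * z) • A = Aᶜ
    rw [mul_smul, show z • A = Aᶜ from hz, Set.smul_set_compl, hmul x y hx hy]
  · exact ne_compl_self ((hmul x y hx hy).symm.trans hxy)

theorem IsTwoCogroup.mul_mem_iff_of_mem_closure {X : Type*} [Group X] {K : Set X}
    (hK : IsTwoCogroup K) {t : X} (ht : t ∈ Subgroup.closure K) :
    ∀ k ∈ K, (k * t ∈ K ↔ t ∉ K) := by
  obtain ⟨-, hinv, htri, hmul⟩ := isTwoCogroup_iff.1 hK
  have step : ∀ y ∈ K, ∀ s, (∀ k ∈ K, (k * s ∈ K ↔ s ∉ K)) →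
      ∀ k ∈ K, (k * (y * s) ∈ K ↔ y * s ∉ K) := fun y hy s hs k hk => by
    rw [hs y hy, not_not]
    constructor
    · intro h
      simpa [mul_assoc] using htri _ (hinv y hy) _ (hinv k hk) _ h
    · intro h
      simpa [mul_assoc] using htri k hk y hy s h
  induction ht using Subgroup.closure_induction_left with
  | one =>
    intro k hk
    have h1 : (1 : X) ∉ K := by simpa using hmul k hk _ (hinv k hk)
    simp [hk, h1]
  | mul_left y hy s _ ih => exact step y hy s ih
  | inv_mul_cancel y hy s _ ih => exact step _ (hinv y hy) s ih

/-- Every 2-cogroup is contained in `Fix⁻(A)` for some `A`. -/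
theorem IsTwoCogroup.exists_subset_setOf_smul_eq_compl {X : Type*} [Group X] {K : Set X}
    (hK : IsTwoCogroup K) : ∃ A : Set X, K ⊆ {x : X | x • A = Aᶜ} := by
  let r := QuotientGroup.rightRel (Subgroup.closure K)
  let rep : X → X := fun a => (Quotient.mk r a).out
  have hrep : ∀ a, a * (rep a)⁻¹ ∈ Subgroup.closure K := fun a =>
    QuotientGroup.rightRel_apply.1 (Quotient.mk_out (s := r) a)
  have hrep_mul : ∀ k ∈ K, ∀ a, rep (k * a) = rep a := fun k hk a => by
    refine congrArg Quotient.out (Quotient.sound (s := r) (QuotientGroup.rightRel_apply.2 ?_))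
    simpa using (Subgroup.closure K).inv_mem (Subgroup.subset_closure hk)
  refine ⟨{a | a * (rep a)⁻¹ ∉ K}, fun k hk => ?_⟩
  have hk' := (isTwoCogroup_iff.1 hK).2.1 k hk
  ext a
  rw [Set.mem_smul_set_iff_inv_smul_mem]
  simp only [smul_eq_mul, Set.mem_ofPred_eq, Set.mem_compl_iff, not_not, hrep_mul _ hk',
    mul_assoc k⁻¹, hK.mul_mem_iff_of_mem_closure (hrep a) _ hk']

/-- In any group `X`: (1) the union of a nonempty inclusion-chain of 2-cogroups
is a 2-cogroup; (2) every 2-cogroup is contained in a maximal 2-cogroup; (3) for every maximal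
2-cogroup `K` there is a twin subset `A ⊆ X` with `Fix⁻(A) = K`. -/
theorem stmt12 {X : Type*} [Group X] :
    (∀ C : Set (Set X), C.Nonempty → (∀ K ∈ C, IsTwoCogroup K) → IsChain (· ⊆ ·) C →
      IsTwoCogroup (⋃₀ C)) ∧
    (∀ K : Set X, IsTwoCogroup K → ∃ M : Set X, IsMaxTwoCogroup M ∧ K ⊆ M) ∧
    (∀ K : Set X, IsMaxTwoCogroup K → ∃ A : Set X, {x : X | x • A = Aᶜ} = K) := by
  refine ⟨fun C => IsTwoCogroup.sUnion, fun K => IsTwoCogroup.exists_isMaxTwoCogroup,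
    fun K hK => ?_⟩
  obtain ⟨A, hA⟩ := hK.1.exists_subset_setOf_smul_eq_compl
  exact ⟨A, hK.2 _ (isTwoCogroup_setOf_smul_eq_compl (hK.1.1.mono hA)) hA⟩
end

section
/- Let K be a maximal 2-cogroup in a group X and let Stab(K) = {x ∈ X : xKx⁻¹ = K}. Then Stab(K) is a subgroup of X containing K·K as a normal subgroup, and the quotient group H(K) = Stab(K)/(K·K) is a 2-group with a unique element of order 2; that is, every element of H(K) has order a power of 2, and there is exactly one element of H(K) of order 2. -/
open Pointwise

/-- The coset `x • H` of a subgroup `H` normalized by `x ∉ H` with `x * x ∈ H` is a 2-cogroup. -/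
theorem isTwoCogroup_smul {X : Type*} [Group X] {x : X} {H : Subgroup X}
    (hx : x ∉ H) (hxx : x * x ∈ H) (hn : x ∈ Subgroup.normalizer (H : Set X)) :
    IsTwoCogroup (x • (H : Set X)) := by
  have mem_left (k : X) : k ∈ x • (H : Set X) ↔ x⁻¹ * k ∈ H := by
    rw [Set.mem_smul_set_iff_inv_smul_mem]; rfl
  have mem_right (k : X) : k ∈ x • (H : Set X) ↔ k * x⁻¹ ∈ H := by
    rw [mem_left, Subgroup.mem_normalizer_iff'.1 (inv_mem hn)]
  have mul_mem {a b : X} (ha : a ∈ x • (H : Set X)) (hb : b ∈ x • (H : Set X)) :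
      a * b ∈ H := by
    have := H.mul_mem (H.mul_mem ((mem_right a).1 ha) hxx) ((mem_left b).1 hb)
    simpa [mul_assoc] using this
  have inv_mem' {a : X} (ha : a ∈ x • (H : Set X)) : a⁻¹ ∈ x • (H : Set X) := by
    rw [mem_left]
    have := H.inv_mem (H.mul_mem ((mem_right a).1 ha) hxx)
    simpa [mul_assoc] using this
  have shift {y : X} (hy : y ∈ x • (H : Set X)) : y • x • (H : Set X) = H := by
    ext h
    rw [Set.mem_smul_set_iff_inv_smul_mem, smul_eq_mul]
    refine ⟨fun h' => by simpa using mul_mem hy h', fun h' => ?_⟩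
    rw [mem_left, ← mul_assoc]
    exact H.mul_mem ((mem_left _).1 (inv_mem' hy)) h'
  refine ⟨⟨x, by simp [mem_left]⟩, fun y hy => ⟨?_, ⟨H, (shift hy).symm⟩, ?_⟩⟩
  · rw [shift hy]
    ext h
    constructor
    · intro h'
      refine ⟨h * y⁻¹, ?_, by simp⟩
      rw [mem_right, mul_assoc]
      exact H.mul_mem h' ((mem_right _).1 (inv_mem' hy))
    · rintro ⟨k, hk, rfl⟩
      exact mul_mem hk hy
  · rw [shift hy, Set.disjoint_left]
    intro h h₁ h₂
    exact hx (by simpa using H.mul_mem (H.inv_mem ((mem_right h).1 h₂)) h₁)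

/-- Every 2-cogroup is a coset of a subgroup as in `isTwoCogroup_smul`. -/
theorem IsTwoCogroup.exists_subgroup {X : Type*} [Group X] {K : Set X} (hK : IsTwoCogroup K) :
    ∃ (x : X) (H : Subgroup X), x ∉ H ∧ x * x ∈ H ∧ x ∈ Subgroup.normalizer (H : Set X) ∧
      (∀ k, k ∈ K ↔ x * k ∈ H) ∧ (∀ k, k ∈ K ↔ k * x ∈ H) := by
  obtain ⟨⟨x, hx⟩, h⟩ := hK
  obtain ⟨hcomm, ⟨H, hH⟩, hdisj⟩ := h x hx
  have mem_left (k : X) : k ∈ K ↔ x * k ∈ H := by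
    rw [← SetLike.mem_coe, hH, ← smul_eq_mul, Set.smul_mem_smul_set_iff]
  have mem_right (k : X) : k ∈ K ↔ k * x ∈ H := by
    rw [← SetLike.mem_coe, hH, hcomm]
    simp
  refine ⟨x, H, fun hxH => ?_, (mem_left x).1 hx, ?_, mem_left, mem_right⟩
  · exact Set.disjoint_left.1 hdisj (hH ▸ hxH) hx
  · refine Subgroup.mem_normalizer_iff'.2 fun k => ?_
    rw [← mem_right, mem_left]

/-- If an involution `z` lies in every nontrivial subgroup, the group is a 2-group with
unique involution `z`. -/
theorem twoGroup_of_mem_of_ne_bot {Q : Type*} [Group Q] {z : Q} (hz : orderOf z = 2)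
    (h : ∀ L : Subgroup Q, z ∉ L → L = ⊥) :
    (∀ g : Q, ∃ n : ℕ, orderOf g = 2 ^ n) ∧ ∃! g : Q, orderOf g = 2 := by
  have mem_zpowers {g : Q} (hg : g ≠ 1) : z ∈ Subgroup.zpowers g := by
    by_contra hzg
    exact hg (Subgroup.zpowers_eq_bot.1 (h _ hzg))
  have dvd_order {g : Q} (hg : g ≠ 1) : 2 ∣ orderOf g := by
    rw [← hz]
    exact orderOf_dvd_of_mem_zpowers (mem_zpowers hg)
  have order_ne_zero (g : Q) : orderOf g ≠ 0 := by
    intro h0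
    have hg : g ≠ 1 := by rintro rfl; simp at h0
    obtain ⟨n, rfl⟩ := mem_zpowers hg
    have hpow : g ^ (n * 2) = 1 := by
      have := pow_orderOf_eq_one (g ^ n)
      rw [hz] at this
      rw [zpow_mul]; exact_mod_cast this
    have := orderOf_dvd_iff_zpow_eq_one.2 hpow
    rw [h0] at this
    have hn : n = 0 := by simpa using this
    simp [hn] at hz
  refine ⟨fun g => ?_, z, hz, fun g hg => ?_⟩
  · obtain ⟨k, m, hm, hkm⟩ := Nat.exists_eq_two_pow_mul_odd (order_ne_zero g)
    refine ⟨k, Nat.dvd_antisymm (orderOf_dvd_of_pow_eq_one ?_) (hkm ▸ dvd_mul_right _ _)⟩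
    by_contra hne
    have hdvd : orderOf (g ^ 2 ^ k) ∣ m := by
      apply orderOf_dvd_of_pow_eq_one
      rw [← pow_mul, ← hkm, pow_orderOf_eq_one]
    exact Nat.not_even_iff_odd.2 hm (even_iff_two_dvd.2 ((dvd_order hne).trans hdvd))
  · have hg1 : g ≠ 1 := by rintro rfl; simp at hg
    obtain ⟨n, hn⟩ := mem_zpowers hg1
    change g ^ n = z at hn
    have hgg : g ^ 2 = 1 := hg ▸ pow_orderOf_eq_one g
    rcases Int.even_or_odd' n with ⟨m, rfl | rfl⟩
    · have : z = 1 := by rw [← hn, zpow_mul]; simp [show g ^ (2 : ℤ) = 1 from mod_cast hgg]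
      simp [this] at hz
    · rw [← hn, zpow_add, zpow_mul]
      simp [show g ^ (2 : ℤ) = 1 from mod_cast hgg]

/-- For a maximal 2-cogroup `K` of a group `X`, the stabilizer
`Stab(K) = {x : xKx⁻¹ = K}` is a subgroup of `X` containing `K·K` as a normal subgroup, and
the characteristic group `H(K) = Stab(K)/(K·K)` is a 2-group with a unique element of
order 2. -/
theorem stmt13 {X : Type*} [Group X] (K : Set X) (hK : IsMaxTwoCogroup K) :
    ∃ (S N : Subgroup X) (_ : N ≤ S) (hN : (N.subgroupOf S).Normal),
      (S : Set X) = {x : X | (fun k => x * k * x⁻¹) '' K = K} ∧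
      (N : Set X) = K * K ∧
      (haveI := hN
       (∀ g : S ⧸ N.subgroupOf S, ∃ n : ℕ, orderOf g = 2 ^ n) ∧
       (∃! g : S ⧸ N.subgroupOf S, orderOf g = 2)) := by
  obtain ⟨x, N, hx, hxx, hxn, mem_left, mem_right⟩ := hK.1.exists_subgroup
  have mul_eq : (N : Set X) = K * K := by
    ext n
    constructor
    · intro hn
      exact ⟨x, (mem_left x).2 hxx, x⁻¹ * n, (mem_left _).2 (by simpa using hn), by simp⟩
    · rintro ⟨a, ha, b, hb, rfl⟩
      have := N.mul_mem (N.mul_mem ((mem_right a).1 ha) (N.inv_mem hxx)) ((mem_left b).1 hb)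
      simpa [mul_assoc] using this
  let S : Subgroup X := (MulAction.stabilizer (MulAut X) K).comap MulAut.conj
  have coe_S : (S : Set X) = {x : X | (fun k => x * k * x⁻¹) '' K = K} := rfl
  have conj_mem {g : X} (hg : g ∈ S) {k : X} (hk : k ∈ K) : g * k * g⁻¹ ∈ K := by
    have hg' : (fun k => g * k * g⁻¹) '' K = K := hg
    exact hg' ▸ Set.mem_image_of_mem (fun k => g * k * g⁻¹) hk
  have mem_S {g : X} (h₁ : ∀ k ∈ K, g * k * g⁻¹ ∈ K) (h₂ : ∀ k ∈ K, g⁻¹ * k * g ∈ K) :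
      g ∈ S := by
    change (fun k => g * k * g⁻¹) '' K = K
    ext k
    exact ⟨by rintro ⟨k, hk, rfl⟩; exact h₁ k hk, fun hk => ⟨_, h₂ k hk, by simp [mul_assoc]⟩⟩
  have hN_conj {n : X} (hn : n ∈ N) {k : X} (hk : k ∈ K) : n * k * n⁻¹ ∈ K := by
    rw [mem_left] at hk ⊢
    have := N.mul_mem (N.mul_mem ((Subgroup.mem_normalizer_iff.1 hxn n).1 hn) hk) (N.inv_mem hn)
    simpa [mul_assoc] using this
  have hNS : N ≤ S := fun n hn =>
    mem_S (fun k hk => hN_conj hn hk) (fun k hk => by simpa using hN_conj (N.inv_mem hn) hk)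
  have hxS : x ∈ S := by
    refine mem_S (fun k hk => ?_) (fun k hk => ?_)
    · rw [mem_right]; simpa using (mem_left k).1 hk
    · rw [mem_left]; simpa [mul_assoc] using (mem_right k).1 hk
  have hnormal : (N.subgroupOf S).Normal := by
    refine ⟨fun n hn g => ?_⟩
    rw [Subgroup.mem_subgroupOf] at hn ⊢
    rw [← SetLike.mem_coe, mul_eq] at hn ⊢
    obtain ⟨a, ha, b, hb, hab⟩ := hn
    refine ⟨_, conj_mem g.2 ha, _, conj_mem g.2 hb, ?_⟩
    simp [← hab, mul_assoc]
  refine ⟨S, N, hNS, hnormal, coe_S, mul_eq, ?_⟩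
  have le_of_notMem {M : Subgroup X} (hNM : N ≤ M) (hMS : M ≤ S) (hxM : x ∉ M) : M ≤ N := by
    have hconj (m : X) (hm : m ∈ M) : x * m * x⁻¹ ∈ M := by
      have h := conj_mem (hMS (M.inv_mem hm)) ((mem_left x).2 hxx)
      rw [mem_left] at h
      have h' := M.mul_mem (hNM hxx) (M.inv_mem (M.mul_mem (hNM h) (M.inv_mem hm)))
      simpa [mul_assoc] using h'
    have hxn' : x ∈ Subgroup.normalizer (M : Set X) := by
      refine Subgroup.mem_normalizer_iff.2 fun m => ⟨hconj m, fun h => ?_⟩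
      have h' := M.mul_mem (M.mul_mem (M.inv_mem (hNM hxx)) (hconj _ h)) (hNM hxx)
      simpa [mul_assoc] using h'
    have hsub : K ⊆ x • (M : Set X) := fun k hk => by
      rw [Set.mem_smul_set_iff_inv_smul_mem]
      have := M.mul_mem (M.inv_mem (hNM hxx)) (hNM ((mem_left k).1 hk))
      simpa [mul_assoc] using this
    have heq := hK.2 _ (isTwoCogroup_smul hxM (hNM hxx) hxn') hsub
    intro m hm
    have hk : x * m ∈ K := heq ▸ Set.smul_mem_smul_set (a := x) hm
    have := N.mul_mem (N.inv_mem hxx) ((mem_left _).1 hk)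
    simpa [mul_assoc] using this
  refine twoGroup_of_mem_of_ne_bot (z := QuotientGroup.mk ⟨x, hxS⟩) ?_ fun L hL => ?_
  · refine orderOf_eq_prime ?_ ?_
    · rw [← QuotientGroup.mk_pow, QuotientGroup.eq_one_iff, Subgroup.mem_subgroupOf]
      simpa [pow_two] using hxx
    · rwa [Ne, QuotientGroup.eq_one_iff, Subgroup.mem_subgroupOf]
  · let M : Subgroup X := (L.comap (QuotientGroup.mk' (N.subgroupOf S))).map S.subtype
    have mem_M (s : S) : (s : X) ∈ M ↔ (s : S ⧸ N.subgroupOf S) ∈ L := by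
      simp [M]
    have hMN : M ≤ N := by
      refine le_of_notMem (fun n hn => ?_) (Subgroup.map_subtype_le _) ?_
      · refine (mem_M ⟨n, hNS hn⟩).2 ?_
        rw [(QuotientGroup.eq_one_iff (N := N.subgroupOf S) ⟨n, hNS hn⟩).2
          (Subgroup.mem_subgroupOf.2 hn)]
        exact L.one_mem
      · rwa [mem_M ⟨x, hxS⟩]
    rw [eq_bot_iff]
    intro q hq
    induction q using QuotientGroup.induction_on with
    | H s =>
      rw [Subgroup.mem_bot, QuotientGroup.eq_one_iff, Subgroup.mem_subgroupOf]
      exact hMN ((mem_M s).2 hq)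
end

section
/- Let K be a maximal 2-cogroup in a group X and let K^± be the subgroup of X with carrier K ∪ K·K. Then the set T_K = {A ⊆ X : Fix⁻(A) = K} has cardinality 2^κ, where κ is the cardinality of the coset space X/K^±. -/
open Pointwise

/-- The set of elements shifting `A` onto its complement. -/
def fixNeg {X : Type*} [Group X] (A : Set X) : Set X := {x | x • A = Aᶜ}

theorem mem_fixNeg_iff {X : Type*} [Group X] {A : Set X} {x : X} :
    x ∈ fixNeg A ↔ ∀ g, x * g ∈ A ↔ g ∉ A := by
  change x • A = Aᶜ ↔ _
  constructor
  · intro h g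
    have h1 : x * g ∈ x • A ↔ x * g ∈ Aᶜ := by rw [h]
    rw [← smul_eq_mul, Set.smul_mem_smul_set_iff, smul_eq_mul, Set.mem_compl_iff] at h1
    tauto
  · intro h
    ext y
    have h1 := h (x⁻¹ * y)
    rw [mul_inv_cancel_left] at h1
    rw [Set.mem_smul_set_iff_inv_smul_mem, smul_eq_mul, Set.mem_compl_iff]
    tauto

theorem smul_fixNeg {X : Type*} [Group X] {A : Set X} {x : X} (hx : x ∈ fixNeg A) :
    x • fixNeg A = MulAction.stabilizer X A := by
  have hc : x • Aᶜ = A := by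
    rw [Set.smul_set_compl, show x • A = Aᶜ from hx, compl_compl]
  ext y
  rw [Set.mem_smul_set_iff_inv_smul_mem, smul_eq_mul, SetLike.mem_coe, MulAction.mem_stabilizer_iff]
  change (x⁻¹ * y) • A = Aᶜ ↔ _
  rw [mul_smul, inv_smul_eq_iff, hc]

theorem image_mul_right_fixNeg {X : Type*} [Group X] {A : Set X} {x : X} (hx : x ∈ fixNeg A) :
    (fun k => k * x) '' fixNeg A = MulAction.stabilizer X A := by
  have hc : x⁻¹ • A = Aᶜ := by
    rw [inv_smul_eq_iff, Set.smul_set_compl, show x • A = Aᶜ from hx, compl_compl]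
  ext y
  rw [Set.image_mul_right, Set.mem_preimage, SetLike.mem_coe, MulAction.mem_stabilizer_iff]
  change (y * x⁻¹) • A = Aᶜ ↔ _
  rw [mul_smul, hc, Set.smul_set_compl, compl_inj_iff]

theorem isTwoCogroup_fixNeg {X : Type*} [Group X] {A : Set X} (h : (fixNeg A).Nonempty) :
    IsTwoCogroup (fixNeg A) := by
  refine ⟨h, fun x hx => ⟨(smul_fixNeg hx).trans (image_mul_right_fixNeg hx).symm,
    ⟨_, (smul_fixNeg hx).symm⟩, ?_⟩⟩
  rw [smul_fixNeg hx, Set.disjoint_left]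
  intro y hy hy'
  have h1 : y • A = A := hy
  have h2 : y • A = Aᶜ := hy'
  exact ne_compl_self (h1.symm.trans h2)

theorem IsMaxTwoCogroup.fixNeg_eq_iff {X : Type*} [Group X] {K A : Set X}
    (hK : IsMaxTwoCogroup K) : fixNeg A = K ↔ K ⊆ fixNeg A :=
  ⟨fun h => h.ge, fun h => hK.2 _ (isTwoCogroup_fixNeg (hK.1.1.mono h)) h⟩

namespace IsTwoCogroup

variable {X : Type*} [Group X] {K : Set X}

theorem inv_mem (hK : IsTwoCogroup K) {x : X} (hx : x ∈ K) : x⁻¹ ∈ K := by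
  obtain ⟨-, ⟨H, hH⟩, -⟩ := hK.2 x hx
  have h1 : (1 : X) ∈ x • K := hH ▸ H.one_mem
  simpa [Set.mem_smul_set_iff_inv_smul_mem] using h1

theorem mul_subset_smul (hK : IsTwoCogroup K) {x : X} (hx : x ∈ K) : K * K ⊆ x • K := by
  obtain ⟨hcomm, ⟨H, hH⟩, -⟩ := hK.2 x hx
  have hl : ∀ k ∈ K, x * k ∈ H := fun k hk => by
    rw [← SetLike.mem_coe, hH]
    exact Set.smul_mem_smul_set hk
  have hr : ∀ k ∈ K, k * x ∈ H := fun k hk => by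
    rw [← SetLike.mem_coe, hH, hcomm]
    exact ⟨k, hk, rfl⟩
  rintro _ ⟨a, ha, b, hb, rfl⟩
  rw [← hH, SetLike.mem_coe]
  have h := H.mul_mem (H.mul_mem (hr a ha) (H.inv_mem (hl x hx))) (hl b hb)
  simpa [mul_assoc] using h

theorem mul_mem_iff (hK : IsTwoCogroup K) {k u : X} (hk : k ∈ K) (hu : u ∈ K ∪ K * K) :
    k * u ∈ K ↔ u ∉ K := by
  constructor
  · exact fun h hu' => Set.disjoint_left.1 (hK.2 k hk).2.2 (Set.smul_mem_smul_set hu') h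
  · intro h
    have h1 := hK.mul_subset_smul (hK.inv_mem hk) (hu.resolve_left h)
    simpa [Set.mem_smul_set_iff_inv_smul_mem] using h1

/-- The sets shifted onto their complements by all elements of a 2-cogroup `K` correspond to the
sets of cosets of `K^±`: from each coset one records the inverse of a fixed representative. -/
noncomputable def equivSetQuotient (hK : IsTwoCogroup K) (Kpm : Subgroup X)
    (hKpm : (Kpm : Set X) = K ∪ K * K) :
    {A : Set X // K ⊆ fixNeg A} ≃ Set (X ⧸ Kpm) where
  toFun A := {q | q.out⁻¹ ∈ A.1}
  invFun S := ⟨{g | g * (↑(g⁻¹) : X ⧸ Kpm).out ∉ K ↔ (↑(g⁻¹) : X ⧸ Kpm) ∈ S}, by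
    intro k hk
    rw [mem_fixNeg_iff]
    intro g
    have hkp : k ∈ Kpm := by
      rw [← SetLike.mem_coe, hKpm]
      exact Or.inl hk
    have hq : (↑((k * g)⁻¹) : X ⧸ Kpm) = ↑(g⁻¹) := by
      rw [QuotientGroup.eq]
      simpa using hkp
    have hu : g * (↑(g⁻¹) : X ⧸ Kpm).out ∈ K ∪ K * K := by
      rw [← hKpm, SetLike.mem_coe]
      simpa using QuotientGroup.eq.1 (QuotientGroup.out_eq' (↑(g⁻¹) : X ⧸ Kpm)).symm
    have h := hK.mul_mem_iff hk hu
    simp only [Set.mem_ofPred_eq]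
    rw [hq, mul_assoc, h]
    tauto⟩
  left_inv := by
    rintro ⟨A, hA⟩
    ext g
    have hu : g * (↑(g⁻¹) : X ⧸ Kpm).out ∈ K ∪ K * K := by
      rw [← hKpm, SetLike.mem_coe]
      simpa using QuotientGroup.eq.1 (QuotientGroup.out_eq' (↑(g⁻¹) : X ⧸ Kpm)).symm
    simp only [Set.mem_ofPred_eq]
    generalize (↑(g⁻¹) : X ⧸ Kpm).out = r at hu ⊢
    by_cases hr : g * r ∈ K
    · have h := mem_fixNeg_iff.1 (hA hr) r⁻¹
      rw [mul_inv_cancel_right] at h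
      tauto
    · obtain ⟨a, ha, b, hb, hab⟩ := hu.resolve_left hr
      have h1 := mem_fixNeg_iff.1 (hA ha) (b * r⁻¹)
      have h2 := mem_fixNeg_iff.1 (hA hb) r⁻¹
      have hg : a * (b * r⁻¹) = g := by
        rw [← mul_assoc, mul_inv_eq_iff_eq_mul]
        exact hab
      rw [hg] at h1
      tauto
  right_inv S := by
    ext q
    have h1 : (1 : X) ∉ K := fun h => by
      have h2 := hK.mul_mem_iff h (Or.inl h)
      rw [mul_one] at h2
      tauto
    simp [h1]

end IsTwoCogroup

/-- For a maximal 2-cogroup `K` of a group `X` and the subgroup `K^±` with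
carrier `K ∪ K·K`, the set `T_K = {A ⊆ X : Fix⁻(A) = K}` has cardinality `2^κ`, where `κ`
is the cardinality of the coset space `X/K^±`. -/
theorem stmt14 {X : Type*} [Group X] (K : Set X) (hK : IsMaxTwoCogroup K)
    (Kpm : Subgroup X) (hKpm : (Kpm : Set X) = K ∪ K * K) :
    Cardinal.mk {A : Set X // {x : X | x • A = Aᶜ} = K} =
      2 ^ Cardinal.mk (X ⧸ Kpm) := by
  rw [← Cardinal.mk_set]
  exact Cardinal.mk_congr ((Equiv.subtypeEquivRight fun _ => hK.fixNeg_eq_iff).trans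
    (hK.1.equivSetQuotient Kpm hKpm))
end

section
/- The family T of twin subsets of a group X is at most countable if and only if every subgroup of infinite index in X is odd, i.e., for every subgroup H of X of infinite index, every element of H has finite odd order. -/
open Pointwise

section TwinSets

variable {X : Type*} [Group X]

theorem Odd.orderOf_of_zpow_eq_one {x : X} {k : ℤ} (hk : Odd k) (h : x ^ k = 1) :
    Odd (orderOf x) := by
  obtain ⟨c, hc⟩ := orderOf_dvd_iff_zpow_eq_one.mpr h
  rw [hc, Int.odd_mul] at hk
  exact_mod_cast hk.1

theorem notMem_zpowers_sq {x : X} (hx : ¬ Odd (orderOf x)) :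
    x ∉ Subgroup.zpowers (x ^ 2) := by
  rintro ⟨k, hk⟩
  refine hx (Odd.orderOf_of_zpow_eq_one (k := 2 * k - 1) ⟨k - 1, by ring⟩ ?_)
  have hk' : x ^ (2 * k) = x := by
    rw [zpow_mul]
    exact_mod_cast hk
  rw [zpow_sub_one, hk', mul_inv_cancel]

theorem zpow_two_mul_mem_zpowers_sq (x : X) (m : ℤ) :
    x ^ (2 * m) ∈ Subgroup.zpowers (x ^ 2) :=
  ⟨m, by simp only [zpow_mul]; norm_cast⟩

theorem inv_mul_mem_zpowers_sq_iff {x c : X} (hx : ¬ Odd (orderOf x))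
    (hc : c ∈ Subgroup.zpowers x) :
    x⁻¹ * c ∈ Subgroup.zpowers (x ^ 2) ↔ c ∉ Subgroup.zpowers (x ^ 2) := by
  constructor
  · intro h1 h2
    refine notMem_zpowers_sq hx ?_
    simpa using mul_mem h2 (inv_mem h1)
  · intro h
    obtain ⟨k, rfl⟩ := hc
    rcases Int.even_or_odd' k with ⟨m, rfl | rfl⟩
    · exact absurd (zpow_two_mul_mem_zpowers_sq x m) h
    · convert zpow_two_mul_mem_zpowers_sq x m using 1
      group

theorem sq_smul_of_smul_eq_compl {x : X} {A : Set X} (h : x • A = Aᶜ) : x ^ 2 • A = A := by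
  rw [sq, mul_smul, h, Set.smul_set_compl, h, compl_compl]

theorem not_odd_orderOf_of_smul_eq_compl {x : X} {A : Set X} (h : x • A = Aᶜ) :
    ¬ Odd (orderOf x) := by
  rintro ⟨k, hk⟩
  have h1 : x ^ (2 * k) • A = A := by
    rw [pow_mul]
    exact (MulAction.stabilizer X A).pow_mem (sq_smul_of_smul_eq_compl h) k
  have h2 : x ^ (2 * k + 1) • A = Aᶜ := by rw [pow_succ', mul_smul, h1, h]
  rw [← hk, pow_orderOf_eq_one, one_smul] at h2
  have h3 : (1 : X) ∈ A ↔ (1 : X) ∈ Aᶜ := by rw [← h2]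
  simp at h3

theorem Subgroup.countable_of_finiteIndex (H : Subgroup X) [Countable H] [Finite (X ⧸ H)] :
    Countable X :=
  Subgroup.groupEquivQuotientProdSubgroup (s := H).injective.countable

theorem Subgroup.finite_setOf_le_stabilizer (H : Subgroup X) [Finite (X ⧸ H)] :
    {A : Set X | H ≤ MulAction.stabilizer X A}.Finite := by
  refine (Set.finite_range
    fun S : Set (X ⧸ H) ↦ {x : X | ((x⁻¹ : X) : X ⧸ H) ∈ S}).subset ?_
  intro A hA
  refine ⟨{q | ∃ a ∈ A, ((a⁻¹ : X) : X ⧸ H) = q}, ?_⟩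
  ext x
  constructor
  · rintro ⟨a, ha, hax⟩
    have hmem : a * x⁻¹ ∈ H := by simpa using QuotientGroup.eq.mp hax
    have hstab : (a * x⁻¹)⁻¹ • A = A := hA (inv_mem hmem)
    rw [← hstab]
    exact ⟨a, ha, by simp⟩
  · exact fun hx ↦ ⟨x, hx, rfl⟩

theorem finite_quotient_zpowers_sq {x : X} [Finite (X ⧸ Subgroup.zpowers x)] :
    Finite (X ⧸ Subgroup.zpowers (x ^ 2)) := by
  have hsurj : Function.Surjective
      fun p : (X ⧸ Subgroup.zpowers x) × Bool ↦
        ((p.1.out * (if p.2 then x else 1) : X) : X ⧸ Subgroup.zpowers (x ^ 2)) := by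
    intro q
    induction q using QuotientGroup.induction_on with
    | H y =>
      obtain ⟨k, hk⟩ : ((y : X ⧸ Subgroup.zpowers x).out)⁻¹ * y ∈ Subgroup.zpowers x :=
        QuotientGroup.eq.mp (QuotientGroup.out_eq' _)
      rcases Int.even_or_odd' k with ⟨m, rfl | rfl⟩
      · refine ⟨(y, false), QuotientGroup.eq.mpr ?_⟩
        simpa [← hk] using zpow_two_mul_mem_zpowers_sq x m
      · refine ⟨(y, true), QuotientGroup.eq.mpr ?_⟩
        convert zpow_two_mul_mem_zpowers_sq x m using 1
        simp only [if_true, mul_inv_rev, mul_assoc, ← hk]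
        group
  exact Finite.of_surjective _ hsurj

theorem countable_twin_of_odd
    (hX : ∀ H : Subgroup X, Infinite (X ⧸ H) → ∀ h : H, Odd (orderOf (h : X))) :
    {A : Set X | ∃ x : X, x • A = Aᶜ}.Countable := by
  have hfin {x : X} (hx : ¬ Odd (orderOf x)) : Finite (X ⧸ Subgroup.zpowers x) := by
    by_contra hinf
    exact hx (hX _ (not_finite_iff_infinite.mp hinf) ⟨x, Subgroup.mem_zpowers x⟩)
  by_cases hodd : ∀ x : X, Odd (orderOf x)
  · convert Set.countable_empty
    refine Set.eq_empty_of_forall_notMem ?_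
    rintro A ⟨x, hx⟩
    exact not_odd_orderOf_of_smul_eq_compl hx (hodd x)
  push Not at hodd
  obtain ⟨z, hz⟩ := hodd
  have := hfin hz
  have : Countable X := (Subgroup.zpowers z).countable_of_finiteIndex
  rw [Set.ofPred_exists]
  refine Set.countable_iUnion fun x ↦ ?_
  by_cases hx : Odd (orderOf x)
  · exact Set.countable_empty.mono fun A hA ↦ not_odd_orderOf_of_smul_eq_compl hA hx
  · have := hfin hx
    have := finite_quotient_zpowers_sq (x := x)
    refine ((Subgroup.zpowers (x ^ 2)).finite_setOf_le_stabilizer.subset ?_).countable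
    intro A hA
    exact (Subgroup.zpowers_le).mpr (sq_smul_of_smul_eq_compl hA)

theorem not_countable_twin_of_not_odd {x : X} [Infinite (X ⧸ Subgroup.zpowers x)]
    (hx : ¬ Odd (orderOf x)) : ¬ {A : Set X | ∃ x : X, x • A = Aᶜ}.Countable := by
  intro hcount
  let π : X → X ⧸ Subgroup.zpowers x := fun y ↦ ((y⁻¹ : X) : X ⧸ Subgroup.zpowers x)
  have hπ (y : X) : π (x⁻¹ * y) = π y :=
    QuotientGroup.eq.mpr (by simp)
  have hsurj : Function.Surjective π := fun q ↦ ⟨q.out⁻¹, by simp [π]⟩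
  have hout (y : X) : y * (π y).out ∈ Subgroup.zpowers x := by
    simpa using QuotientGroup.eq.mp (QuotientGroup.out_eq' (π y)).symm
  let F : Set (X ⧸ Subgroup.zpowers x) → Set X := fun S ↦
    {y | y * (π y).out ∈ Subgroup.zpowers (x ^ 2) ↔ π y ∈ S}
  have hF (S) : x • F S = (F S)ᶜ := by
    ext y
    have := inv_mul_mem_zpowers_sq_iff hx (hout y)
    simp only [Set.mem_smul_set_iff_inv_smul_mem, smul_eq_mul, Set.mem_compl_iff, F,
      Set.mem_ofPred_eq, hπ, mul_assoc, this]
    tauto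
  have hinj : Function.Injective F := by
    intro S S' h
    ext q
    obtain ⟨y, rfl⟩ := hsurj q
    have : y ∈ F S ↔ y ∈ F S' := by rw [h]
    simp only [F, Set.mem_ofPred_eq] at this
    tauto
  have hrange : (Set.range F).Countable := hcount.mono (by rintro _ ⟨S, rfl⟩; exact ⟨x, hF S⟩)
  have : Countable (Set (X ⧸ Subgroup.zpowers x)) :=
    Set.countable_univ_iff.mp <| Set.countable_of_injective_of_countable_image hinj.injOn
      (by rwa [Set.image_univ])
  obtain ⟨g, hg⟩ := Countable.exists_injective_nat (Set (X ⧸ Subgroup.zpowers x))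
  exact Function.cantor_injective _
    ((Infinite.natEmbedding (X ⧸ Subgroup.zpowers x)).injective.comp hg)

end TwinSets

/-- The family `T` of twin subsets of a group `X` is at most countable if and
only if every subgroup of infinite index in `X` is odd (each of its elements has finite odd
order). -/
theorem stmt17 {X : Type*} [Group X] :
    {A : Set X | ∃ x : X, x • A = Aᶜ}.Countable ↔
    (∀ H : Subgroup X, Infinite (X ⧸ H) → ∀ h : H, Odd (orderOf (h : X))) := by
  refine ⟨fun hcount H hH h ↦ ?_, countable_twin_of_odd⟩
  by_contra hodd
  have hle : Subgroup.zpowers (h : X) ≤ H := Subgroup.zpowers_le.mpr h.2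
  have : Infinite (X ⧸ Subgroup.zpowers (h : X)) :=
    Infinite.of_surjective (Subgroup.quotientMapOfLE hle) fun q ↦ by
      induction q using QuotientGroup.induction_on with
      | H y => exact ⟨y, rfl⟩
  exact not_countable_twin_of_not_odd hodd hcount
end

section
/- Let H be a group acting freely on a set X (i.e., h•x = x implies h = 1), and let End(X) be the monoid, under composition, of all equivariant maps f : X → X (f(h•x) = h•f(x) for all h ∈ H, x ∈ X). Let M = {f ∈ End(X) : all values of f lie in a single H-orbit, i.e., for all x, y ∈ X there is h ∈ H with f(x) = h•f(y)}. Then M is the minimal ideal of End(X): M is a two-sided ideal (g∘f ∈ M and f∘g ∈ M for all f ∈ M, g ∈ End(X)), and M is contained in every nonempty two-sided ideal of End(X). -/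
/-- If `H` acts freely on `X`, then any point can be sent to any other point by an equivariant
self-map of `X`. -/
theorem exists_equivariant_map_apply_eq {H X : Type*} [Group H] [MulAction H X]
    (hfree : ∀ (h : H) (x : X), h • x = x → h = 1) (z y : X) :
    ∃ g : X → X, (∀ (h : H) (x : X), g (h • x) = h • g x) ∧ g z = y := by
  classical
  let g : X → X := fun x => if hx : ∃ h : H, h • z = x then hx.choose • y else x
  have g_orbit (h : H) : g (h • z) = h • y := by
    have hx : ∃ k : H, k • z = h • z := ⟨h, rfl⟩
    have key : h⁻¹ * hx.choose = 1 :=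
      hfree _ z (by rw [mul_smul, hx.choose_spec, inv_smul_smul])
    simp only [g, dif_pos hx]
    rw [← inv_mul_eq_one.mp key]
  refine ⟨g, fun h x => ?_, by simpa using g_orbit 1⟩
  by_cases hx : ∃ k : H, k • z = x
  · obtain ⟨k, rfl⟩ := hx
    rw [g_orbit, smul_smul, g_orbit, mul_smul]
  · have hx' : ¬ ∃ k : H, k • z = h • x := fun ⟨k, hk⟩ =>
      hx ⟨h⁻¹ * k, by rw [mul_smul, hk, inv_smul_smul]⟩
    simp only [g, dif_neg hx, dif_neg hx']

/-- Let a group `H` act freely on a set `X` and let `End(X)` be the monoid of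
equivariant self-maps of `X` under composition. The set
`M = {f equivariant : all values of f lie in one H-orbit}` is the minimal ideal of `End(X)`:
it is a two-sided ideal and it is contained in every nonempty two-sided ideal of `End(X)`. -/
theorem stmt18 {H X : Type*} [Group H] [MulAction H X]
    (hfree : ∀ (h : H) (x : X), h • x = x → h = 1)
    (M : Set (X → X))
    (hM : M = {f : X → X | (∀ (h : H) (x : X), f (h • x) = h • f x) ∧
                ∀ x y : X, ∃ h : H, f x = h • f y}) :
    ((∀ f ∈ M, (∀ (h : H) (x : X), f (h • x) = h • f x)) ∧
     (∀ f ∈ M, ∀ g : X → X, (∀ (h : H) (x : X), g (h • x) = h • g x) →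
        g ∘ f ∈ M ∧ f ∘ g ∈ M)) ∧
    (∀ J : Set (X → X), J.Nonempty →
      (∀ f ∈ J, (∀ (h : H) (x : X), f (h • x) = h • f x)) →
      (∀ f ∈ J, ∀ g : X → X, (∀ (h : H) (x : X), g (h • x) = h • g x) →
        g ∘ f ∈ J ∧ f ∘ g ∈ J) →
      M ⊆ J) := by
  subst hM
  refine ⟨⟨fun f hf => hf.1, ?_⟩, ?_⟩
  · rintro f ⟨hf, hfo⟩ g hg
    refine ⟨⟨fun h x => ?_, fun x y => ?_⟩, fun h x => ?_, fun x y => hfo (g x) (g y)⟩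
    · simp only [Function.comp_apply, hf, hg]
    · obtain ⟨h, hh⟩ := hfo x y
      exact ⟨h, by simp only [Function.comp_apply, hh, hg]⟩
    · simp only [Function.comp_apply, hf, hg]
  · rintro J ⟨j, hj⟩ hJ hideal f ⟨hf, hfo⟩
    obtain hX | ⟨⟨x₀⟩⟩ := isEmpty_or_nonempty X
    · rwa [Subsingleton.elim f j]
    · obtain ⟨g, hg, hgz⟩ := exists_equivariant_map_apply_eq hfree (j (f x₀)) (f x₀)
      have hmem := (hideal _ (hideal j hj f hf).2 g hg).1
      have heq : g ∘ j ∘ f = f := by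
        funext x
        obtain ⟨h, hh⟩ := hfo x x₀
        simp only [Function.comp_apply, hh, hJ j hj, hg, hgz]
      rwa [heq] at hmem
end
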